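/- arXiv:1909.11526 — 7 statements merged into one kernel-verified Lean document; each statement's English description precedes it below -/
import Mathlib

section
/- Let n ≥ 1 be an integer, let p ≥ 1 be a real number and γ ∈ ℝ with γ ≠ 1 − p. Then for every smooth function f : ℝⁿ × ℝ → ℝ whose (compact) support is contained in the open half-space {(x,y) ∈ ℝⁿ × ℝ : y > 0}, one has ∫ |f(x,y)/y|^p · y^{-γ} dx dy ≤ (p/|p + γ − 1|)^p · ∫ |∂_y f(x,y)|^p · y^{-γ} dx dy, where the integrals are over the half-space. (Proposition 3.1, weighted L^p Hardy inequality) -/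
open MeasureTheory

noncomputable section

/-- The open upper half-space `H^{n+1} = ℝⁿ × (0,∞)`. -/
def halfSpace (n : ℕ) : Set ((Fin n → ℝ) × ℝ) := {x | 0 < x.2}

/-- The tangent line inequality for `t ↦ |t| ^ p` at a point of modulus `A` and sign `s`. -/
lemma rpow_add_mul_le_abs_rpow {p A s b : ℝ} (hp : 1 ≤ p) (hA : 0 < A) (hs : |s| ≤ 1) :
    A ^ p + p * A ^ (p - 1) * (s * b - A) ≤ |b| ^ p := by
  have h := one_add_mul_self_le_rpow_one_add (s := |b| / A - 1)
    (by linarith [div_nonneg (abs_nonneg b) hA.le]) hp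
  rw [add_sub_cancel, Real.div_rpow (abs_nonneg b) hA.le, le_div_iff₀ (by positivity)] at h
  have hAp : A ^ p = A ^ (p - 1) * A := by
    rw [← Real.rpow_add_one hA.ne', sub_add_cancel]
  have hsb : s * b ≤ |b| := (le_abs_self _).trans <| by
    rw [abs_mul]
    exact mul_le_of_le_one_left (abs_nonneg b) hs
  calc A ^ p + p * A ^ (p - 1) * (s * b - A)
      ≤ A ^ p + p * A ^ (p - 1) * (|b| - A) := by gcongr
    _ = (1 + p * (|b| / A - 1)) * A ^ p := by
      rw [hAp]
      field_simp
    _ ≤ |b| ^ p := h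

/-- The `p`-th power of the modulus of a compactly supported `C¹` function is Lipschitz. -/
lemma ContDiff.exists_lipschitzWith_abs_rpow {E : Type*} [NormedAddCommGroup E] [NormedSpace ℝ E]
    {g : E → ℝ} (hg : ContDiff ℝ 1 g) (hgc : HasCompactSupport g) {p : ℝ} (hp : 1 ≤ p) :
    ∃ C, LipschitzWith C fun x ↦ |g x| ^ p := by
  obtain ⟨C, hC⟩ := hg.lipschitzWith_of_hasCompactSupport hgc one_ne_zero
  obtain ⟨M, hM⟩ := hgc.exists_bound_of_continuous hg.continuous
  have hpow : ContDiff ℝ 1 fun t : ℝ ↦ t ^ p :=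
    Real.contDiff_rpow_const_of_le (n := 1) (by simpa using hp)
  obtain ⟨D, hD⟩ := hpow.contDiffOn.exists_lipschitzOnWith one_ne_zero
    (convex_Icc 0 M) isCompact_Icc
  have habs : LipschitzWith (1 * C) fun x ↦ |g x| := lipschitzWith_one_norm.comp hC
  exact ⟨_, lipschitzOnWith_univ.1 <|
    hD.comp habs.lipschitzOnWith fun x _ ↦ ⟨abs_nonneg _, hM x⟩⟩

/-- The line derivatives of a compactly supported Lipschitz function have integral zero. -/
lemma LipschitzWith.integral_lineDeriv_eq_zero {E : Type*} [NormedAddCommGroup E]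
    [NormedSpace ℝ E] [MeasurableSpace E] [BorelSpace E] [FiniteDimensional ℝ E]
    {μ : Measure E} [μ.IsAddHaarMeasure] {C : NNReal} {F : E → ℝ} (hF : LipschitzWith C F)
    (hFc : HasCompactSupport F) (v : E) : ∫ x, lineDeriv ℝ F x v ∂μ = 0 := by
  have h := (LipschitzWith.const (1 : ℝ)).integral_lineDeriv_mul_eq (μ := μ) hF hFc (-v)
  simpa [lineDeriv] using h.symm

/-- The line derivatives of a compactly supported Lipschitz function are integrable. -/
lemma LipschitzWith.integrable_lineDeriv {E : Type*} [NormedAddCommGroup E]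
    [NormedSpace ℝ E] [MeasurableSpace E] [BorelSpace E] [FiniteDimensional ℝ E]
    {μ : Measure E} [IsFiniteMeasureOnCompacts μ] {C : NNReal} {F : E → ℝ}
    (hF : LipschitzWith C F) (hFc : HasCompactSupport F) (v : E) :
    Integrable (fun x ↦ lineDeriv ℝ F x v) μ := by
  have hsub : Function.support (fun x ↦ lineDeriv ℝ F x v) ⊆ tsupport F := by
    intro x hx
    by_contra hxF
    apply hx
    have h0 : F =ᶠ[nhds x] fun _ ↦ 0 := notMem_tsupport_iff_eventuallyEq.1 hxF
    exact h0.lineDeriv_eq.trans (by simp [lineDeriv])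
  rw [← integrableOn_iff_integrable_of_support_subset hsub]
  exact (hF.memLp_lineDeriv v).locallyIntegrable le_top |>.integrableOn_isCompact hFc

section HalfSpace

variable {n : ℕ} {f : (Fin n → ℝ) × ℝ → ℝ}

lemma contDiff_mul_snd_rpow {m : WithTop ℕ∞} (hf : ContDiff ℝ m f)
    (hfs : tsupport f ⊆ halfSpace n) (r : ℝ) : ContDiff ℝ m fun x ↦ f x * x.2 ^ r := by
  refine contDiff_iff_contDiffAt.2 fun x ↦ ?_
  by_cases hx : x ∈ tsupport f
  swap
  · have h0 : (fun x ↦ f x * x.2 ^ r) =ᶠ[nhds x] fun _ ↦ 0 := by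
      filter_upwards [notMem_tsupport_iff_eventuallyEq.1 hx] with z hz
      simp [hz]
    exact contDiffAt_const.congr_of_eventuallyEq h0
  have hx0 : 0 < x.2 := hfs hx
  exact hf.contDiffAt.mul (contDiffAt_snd.rpow_const_of_ne hx0.ne')

lemma snd_pos_of_ne_zero (hfs : tsupport f ⊆ halfSpace n) {x : (Fin n → ℝ) × ℝ} (hx : f x ≠ 0) :
    0 < x.2 :=
  hfs (subset_tsupport f hx)

lemma exists_lipschitzWith_abs_rpow_mul_snd_rpow (hf : ContDiff ℝ 1 f)
    (hfc : HasCompactSupport f) (hfs : tsupport f ⊆ halfSpace n) {p : ℝ} (hp : 1 ≤ p) (c : ℝ) :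
    ∃ C, LipschitzWith C fun x ↦ |f x| ^ p * x.2 ^ (-c) := by
  have hp0 : p ≠ 0 := by positivity
  have h := (contDiff_mul_snd_rpow hf hfs (-c / p)).exists_lipschitzWith_abs_rpow
    hfc.mul_right hp
  suffices (fun x ↦ |f x| ^ p * x.2 ^ (-c)) = fun x ↦ |f x * x.2 ^ (-c / p)| ^ p by rwa [this]
  funext x
  by_cases hx : f x = 0
  · simp [hx, Real.zero_rpow hp0]
  have hx0 := snd_pos_of_ne_zero hfs hx
  rw [abs_mul, Real.mul_rpow (abs_nonneg _) (abs_nonneg _), abs_of_pos (Real.rpow_pos_of_pos hx0 _),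
    ← Real.rpow_mul hx0.le, div_mul_cancel₀ _ hp0]

lemma lineDeriv_abs_rpow_mul_snd_rpow {x : (Fin n → ℝ) × ℝ} (hf : DifferentiableAt ℝ f x)
    (hx : f x ≠ 0) (hx0 : 0 < x.2) (p c : ℝ) :
    lineDeriv ℝ (fun x ↦ |f x| ^ p * x.2 ^ (-c)) x (0, 1) =
      p * |f x| ^ (p - 1) * (SignType.sign (f x) * fderiv ℝ f x (0, 1)) * x.2 ^ (-c)
        - c * |f x| ^ p * x.2 ^ (-c - 1) := by
  have h₁ : HasDerivAt (fun t : ℝ ↦ f (x + t • (0, 1))) (fderiv ℝ f x (0, 1)) 0 :=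
    hf.hasFDerivAt.hasLineDerivAt (0, 1)
  have h₂ : HasDerivAt (fun t : ℝ ↦ (x + t • ((0 : Fin n → ℝ), (1 : ℝ))).2) 1 0 := by
    simpa using (hasDerivAt_id (0 : ℝ)).const_add x.2
  have h₃ := (hasDerivAt_abs (x := f (x + (0 : ℝ) • (0, 1)))
    (by simpa only [zero_smul, add_zero] using hx)).comp 0 h₁
  have h₄ := (h₃.rpow_const (p := p) (Or.inl (by simpa only [Function.comp_apply, zero_smul, add_zero, abs_ne_zero] using hx))).mul
    (h₂.rpow_const (p := -c) (Or.inl (by simpa using hx0.ne')))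
  have h₅ : HasLineDerivAt ℝ (fun x ↦ |f x| ^ p * x.2 ^ (-c)) _ x (0, 1) := h₄
  rw [h₅.lineDeriv]
  simp only [Function.comp_apply, zero_smul, add_zero]
  ring

/-- The pointwise form of the Hardy inequality, up to an exact derivative. -/
lemma abs_div_rpow_mul_le_sub_lineDeriv (hf : Differentiable ℝ f)
    (hfs : tsupport f ⊆ halfSpace n) {p γ : ℝ} (hp : 1 ≤ p) (hγ : p + γ - 1 ≠ 0)
    {x : (Fin n → ℝ) × ℝ} (hxf : 0 ≤ |fderiv ℝ f x (0, 1)| ^ p * x.2 ^ (-γ)) :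
    |f x / x.2| ^ p * x.2 ^ (-γ) ≤
      (p / |p + γ - 1|) ^ p * (|fderiv ℝ f x (0, 1)| ^ p * x.2 ^ (-γ)) -
        p / (p + γ - 1) *
          lineDeriv ℝ (fun x ↦ |f x| ^ p * x.2 ^ (-(p + γ - 1))) x (0, 1) := by
  have hp0 : 0 < p := by positivity
  set c := p + γ - 1 with hc
  by_cases hx : f x = 0
  · have hmin : IsLocalMin (fun x ↦ |f x| ^ p * x.2 ^ (-c)) x := .of_forall fun z ↦ by
      by_cases hz : f z = 0
      · simp [hx, hz, Real.zero_rpow hp0.ne']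
      · have := snd_pos_of_ne_zero hfs hz
        simp only [hx, abs_zero, Real.zero_rpow hp0.ne', zero_mul]
        positivity
    rw [hmin.lineDeriv_eq_zero]
    simp only [hx, zero_div, abs_zero, Real.zero_rpow hp0.ne', zero_mul, Pi.zero_apply, mul_zero,
      sub_zero]
    positivity
  have hy := snd_pos_of_ne_zero hfs hx
  rw [lineDeriv_abs_rpow_mul_snd_rpow hf.differentiableAt hx hy]
  have hA : 0 < |f x| := abs_pos.2 hx
  set s : ℝ := ((SignType.sign (f x) : SignType) : ℝ) with hs
  set A := |f x|
  set y := x.2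
  set b := fderiv ℝ f x (0, 1)
  have hs1 : |s| ≤ 1 := by
    rcases lt_or_gt_of_ne hx with h | h <;> simp [hs, h]
  have key := rpow_add_mul_le_abs_rpow (b := p / c * b) hp (div_pos hA hy) hs1
  have hb : |p / c * b| ^ p = (p / |c|) ^ p * |b| ^ p := by
    rw [abs_mul, abs_div, abs_of_pos hp0, Real.mul_rpow (by positivity) (abs_nonneg _)]
  have hyγ : 0 < y ^ (-γ) := Real.rpow_pos_of_pos hy _
  have e₁ : y ^ (-c) = y ^ (-γ) / y ^ (p - 1) := by
    rw [← Real.rpow_sub hy]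
    congr 1
    rw [hc]
    ring
  have e₂ : y ^ (-c - 1) = y ^ (-γ) / y ^ (p - 1) / y := by
    rw [Real.rpow_sub_one hy.ne', e₁]
  have e₃ : A ^ p = A ^ (p - 1) * A := by
    rw [← Real.rpow_add_one hA.ne', sub_add_cancel]
  have e₄ : (A / y) ^ (p - 1) = A ^ (p - 1) / y ^ (p - 1) := Real.div_rpow hA.le hy.le _
  have habs : |f x / y| = A / y := by rw [abs_div, abs_of_pos hy]
  rw [habs, ← mul_assoc, ← hb, le_sub_iff_add_le]
  calc _ = ((A / y) ^ p + p * (A / y) ^ (p - 1) * (s * (p / c * b) - A / y)) * y ^ (-γ) := by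
        rw [e₁, e₂, e₃, e₄]
        have : y ^ (p - 1) ≠ 0 := (Real.rpow_pos_of_pos hy _).ne'
        field_simp
    _ ≤ _ := by gcongr

lemma integrable_abs_rpow_mul_snd_rpow {g : (Fin n → ℝ) × ℝ → ℝ} (hg : Continuous g)
    (hgc : HasCompactSupport g) (hgs : tsupport g ⊆ halfSpace n) {p : ℝ} (hp : 0 < p) (r : ℝ) :
    Integrable fun x ↦ |g x| ^ p * x.2 ^ r := by
  have hsub : tsupport (fun x ↦ |g x| ^ p) ⊆ tsupport g :=
    closure_mono fun x hx h ↦ hx (by simp [h, Real.zero_rpow hp.ne'])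
  have hcont : Continuous fun x ↦ |g x| ^ p :=
    hg.abs.rpow_const fun _ ↦ Or.inr hp.le
  exact (contDiff_mul_snd_rpow (contDiff_zero.2 hcont) (hsub.trans hgs) r).continuous
    |>.integrable_of_hasCompactSupport
      (HasCompactSupport.mul_right (hgc.of_isClosed_subset (isClosed_tsupport _) hsub))

end HalfSpace

/-- Proposition 3.1: the weighted `L^p` Hardy inequality on the half-space, for smooth
functions with compact support contained in the open half-space. -/
theorem prop_3_1 (n : ℕ) (hn : 1 ≤ n) (p γ : ℝ) (hp : 1 ≤ p) (hγ : γ ≠ 1 - p)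
    (f : (Fin n → ℝ) × ℝ → ℝ) (hf : ContDiff ℝ (⊤ : ℕ∞) f) (hfc : HasCompactSupport f)
    (hfs : tsupport f ⊆ halfSpace n) :
    ∫ x in halfSpace n, |f x / x.2| ^ p * x.2 ^ (-γ)
      ≤ (p / |p + γ - 1|) ^ p *
        ∫ x in halfSpace n, |fderiv ℝ f x (0, 1)| ^ p * x.2 ^ (-γ) := by
  have hp0 : 0 < p := by positivity
  have hc : p + γ - 1 ≠ 0 := fun h ↦ hγ (by linarith)
  have hf1 : ContDiff ℝ 1 f := hf.of_le (by exact_mod_cast le_top)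
  have hDs : tsupport (fun x ↦ fderiv ℝ f x (0, 1)) ⊆ tsupport f :=
    tsupport_fderiv_apply_subset ℝ (0, 1)
  have hDcont : Continuous fun x ↦ fderiv ℝ f x (0, 1) :=
    (hf1.continuous_fderiv one_ne_zero).clm_apply continuous_const
  have hDint := integrable_abs_rpow_mul_snd_rpow hDcont
    (hfc.of_isClosed_subset (isClosed_tsupport _) hDs) (hDs.trans hfs) hp0 (-γ)
  obtain ⟨C, hF⟩ := exists_lipschitzWith_abs_rpow_mul_snd_rpow hf1 hfc hfs hp (p + γ - 1)
  have hFc : HasCompactSupport fun x ↦ |f x| ^ p * x.2 ^ (-(p + γ - 1)) :=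
    hfc.mono fun x hx h ↦ hx (by simp [h, Real.zero_rpow hp0.ne'])
  have hD0 : ∀ x, x ∉ halfSpace n → |fderiv ℝ f x (0, 1)| ^ p * x.2 ^ (-γ) = 0 := fun x hx ↦ by
    have h : fderiv ℝ f x (0, 1) = 0 := by
      by_contra h
      exact hx (hfs (hDs (subset_tsupport _ h)))
    simp [h, Real.zero_rpow hp0.ne']
  have hf0 : ∀ x, x ∉ halfSpace n → |f x / x.2| ^ p * x.2 ^ (-γ) = 0 := fun x hx ↦ by
    have h : f x = 0 := by
      by_contra h
      exact hx (hfs (subset_tsupport _ h))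
    simp [h, Real.zero_rpow hp0.ne']
  have nonneg {u : (Fin n → ℝ) × ℝ → ℝ}
      (hu : ∀ x, x ∉ halfSpace n → |u x| ^ p * x.2 ^ (-γ) = 0) (x : (Fin n → ℝ) × ℝ) :
      0 ≤ |u x| ^ p * x.2 ^ (-γ) := by
    by_cases hx : x ∈ halfSpace n
    · exact mul_nonneg (by positivity) (Real.rpow_nonneg (le_of_lt hx) _)
    · exact (hu x hx).ge
  rw [setIntegral_eq_integral_of_forall_compl_eq_zero hf0,
    setIntegral_eq_integral_of_forall_compl_eq_zero hD0]
  have : (volume : Measure ((Fin n → ℝ) × ℝ)).IsAddHaarMeasure :=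
    Measure.prod.instIsAddHaarMeasure volume volume
  have hFint := hF.integrable_lineDeriv (μ := volume) hFc (0, 1)
  have hmono := integral_mono_of_nonneg (μ := volume) (.of_forall (nonneg hf0))
    ((hDint.const_mul ((p / |p + γ - 1|) ^ p)).sub (hFint.const_mul (p / (p + γ - 1))))
    (.of_forall fun x ↦ abs_div_rpow_mul_le_sub_lineDeriv (hf1.differentiable one_ne_zero)
      hfs hp hc (nonneg hD0 x))
  refine hmono.trans_eq ?_
  simp only [Pi.sub_apply]
  rw [integral_sub (hDint.const_mul _) (hFint.const_mul _), integral_const_mul,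
    integral_const_mul, hF.integral_lineDeriv_eq_zero hFc, mul_zero, sub_zero]
end
end

section
/- Let n ≥ 1 be an integer, γ ∈ ℝ with γ ≠ −1, and let G be an open subset of the half-space H^{(n+1)}. Suppose c > 0 is a constant such that ∫_G |ψ/y|² y^{-γ} dx dy ≤ c² ∫_G |∂_y ψ|² y^{-γ} dx dy for every smooth ψ with compact support contained in G. (i) If G contains an open box Q^{(n)} × (a,b) with Q^{(n)} a nonempty open box in ℝⁿ and 0 < a < b, then c ≥ (((1+γ)/2)² + (π/ln(b/a))²)^{-1/2}. (ii) If G contains a box of the form Q^{(n)} × (0,b) with b > 0, then c ≥ 2/|1+γ|. (Lemma 3.2, box criterion) -/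
open MeasureTheory

noncomputable section

/-- A nonempty open box in ℝⁿ. -/
def openBox (n : ℕ) (lo hi : Fin n → ℝ) : Set (Fin n → ℝ) :=
  Set.univ.pi fun i => Set.Ioo (lo i) (hi i)

/-- A smooth ramp, vanishing on `(-∞, 0]`, of slope at most one. -/
def smoothRamp (u : ℝ) : ℝ := u * expNegInvGlue u

theorem smoothRamp_contDiff : ContDiff ℝ (⊤ : ℕ∞) smoothRamp :=
  contDiff_id.mul expNegInvGlue.contDiff

theorem smoothRamp_of_nonpos {u : ℝ} (hu : u ≤ 0) : smoothRamp u = 0 := by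
  simp [smoothRamp, expNegInvGlue.zero_of_nonpos hu]

theorem smoothRamp_of_pos {u : ℝ} (hu : 0 < u) : smoothRamp u = u * Real.exp (-u⁻¹) := by
  simp [smoothRamp, expNegInvGlue, not_le.2 hu]

theorem smoothRamp_nonneg (u : ℝ) : 0 ≤ smoothRamp u := by
  rcases le_or_gt u 0 with hu | hu
  · rw [smoothRamp_of_nonpos hu]
  · rw [smoothRamp_of_pos hu]; positivity

theorem sub_one_le_smoothRamp (u : ℝ) : u - 1 ≤ smoothRamp u := by
  rcases le_or_gt u 0 with hu | hu
  · rw [smoothRamp_of_nonpos hu]; linarith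
  · rw [smoothRamp_of_pos hu]
    have h := Real.add_one_le_exp (-u⁻¹)
    have h2 := mul_le_mul_of_nonneg_left h hu.le
    have h3 : u * (-u⁻¹ + 1) = u - 1 := by field_simp; ring
    linarith

theorem abs_deriv_smoothRamp_le (u : ℝ) : |deriv smoothRamp u| ≤ 1 := by
  rcases le_or_gt u 0 with hu | hu
  · have : IsLocalMin smoothRamp u := Filter.Eventually.of_forall fun v => by
      rw [smoothRamp_of_nonpos hu]; exact smoothRamp_nonneg v
    simp [this.deriv_eq_zero]
  · have h1 : HasDerivAt (fun v : ℝ => v * Real.exp (-v⁻¹))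
        (1 * Real.exp (-u⁻¹) + u * (Real.exp (-u⁻¹) * (-(-(u ^ 2)⁻¹)))) u :=
      (hasDerivAt_id u).mul ((hasDerivAt_inv hu.ne').neg.exp)
    have h2 : smoothRamp =ᶠ[nhds u] fun v : ℝ => v * Real.exp (-v⁻¹) := by
      filter_upwards [lt_mem_nhds hu] with v hv using smoothRamp_of_pos hv
    rw [h2.deriv_eq, h1.deriv]
    have h3 : 1 * Real.exp (-u⁻¹) + u * (Real.exp (-u⁻¹) * (-(-(u ^ 2)⁻¹)))
        = (u⁻¹ + 1) * Real.exp (-u⁻¹) := by field_simp; ring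
    rw [h3, abs_of_nonneg (by positivity)]
    calc (u⁻¹ + 1) * Real.exp (-u⁻¹) ≤ Real.exp u⁻¹ * Real.exp (-u⁻¹) := by
          gcongr; exact Real.add_one_le_exp _
      _ = 1 := by rw [← Real.exp_add]; simp

/-- Smooth truncation from below of a sine wave at level `ε`. -/
theorem exists_truncated_sin (k d : ℝ) {ε : ℝ} (hε : 0 < ε) :
    ∃ H : ℝ → ℝ, ContDiff ℝ (⊤ : ℕ∞) H ∧ (∀ t, Real.sin (k * t - d) ≤ ε → H t = 0) ∧
      (∀ t, 0 ≤ H t) ∧ (∀ t, Real.sin (k * t - d) - 2 * ε ≤ H t) ∧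
      ∀ t, (deriv H t) ^ 2 ≤ k ^ 2 * Real.cos (k * t - d) ^ 2 := by
  refine ⟨fun t => ε * smoothRamp ((Real.sin (k * t - d) - ε) / ε), ?_, ?_, ?_, ?_, ?_⟩
  · exact contDiff_const.mul (smoothRamp_contDiff.comp (((Real.contDiff_sin.comp
      ((contDiff_const.mul contDiff_id).sub contDiff_const)).sub contDiff_const).div_const _))
  · intro t ht
    simp only
    rw [smoothRamp_of_nonpos (div_nonpos_of_nonpos_of_nonneg (by linarith) hε.le), mul_zero]
  · exact fun t => mul_nonneg hε.le (smoothRamp_nonneg _)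
  · intro t
    have h := mul_le_mul_of_nonneg_left
      (sub_one_le_smoothRamp ((Real.sin (k * t - d) - ε) / ε)) hε.le
    have h3 : ε * ((Real.sin (k * t - d) - ε) / ε - 1) = Real.sin (k * t - d) - 2 * ε := by
      field_simp; ring
    linarith
  · intro t
    have h0 : HasDerivAt (fun t : ℝ => k * t - d) k t := by
      simpa using ((hasDerivAt_id t).const_mul k).sub_const d
    have h1 := ((h0.sin.sub_const ε).div_const ε)
    have h2 := (((smoothRamp_contDiff.differentiable (by simp)).differentiableAt.hasDerivAt).comp t
      h1).const_mul ε
    have h3 := h2.deriv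
    simp only [Function.comp_def] at h3
    rw [h3]
    have h4 := abs_deriv_smoothRamp_le ((Real.sin (k * t - d) - ε) / ε)
    generalize deriv smoothRamp ((Real.sin (k * t - d) - ε) / ε) = D at h4
    have h5 : ε * (D * (Real.cos (k * t - d) * k / ε)) = D * (k * Real.cos (k * t - d)) := by
      field_simp
    rw [h5, mul_pow, ← mul_pow k]
    have h6 : D ^ 2 ≤ 1 := (sq_le_one_iff_abs_le_one D).2 h4
    nlinarith [sq_nonneg (k * Real.cos (k * t - d))]

theorem integral_sq_const_mul_add_deriv {H : ℝ → ℝ} (hH : ContDiff ℝ (⊤ : ℕ∞) H) (m : ℝ)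
    {α β : ℝ} (hα : H α = 0) (hβ : H β = 0) :
    ∫ t in α..β, (m * H t + deriv H t) ^ 2
      = m ^ 2 * (∫ t in α..β, H t ^ 2) + ∫ t in α..β, deriv H t ^ 2 := by
  have hc : Continuous H := hH.continuous
  have hc' : Continuous (deriv H) := hH.continuous_deriv (by simp)
  have h0 : ∫ t in α..β, 2 * H t * deriv H t = 0 := by
    rw [intervalIntegral.integral_eq_sub_of_hasDerivAt (f := fun t => H t ^ 2)]
    · simp [hα, hβ]
    · intro t _
      simpa using ((hH.differentiable (by simp)).differentiableAt (x := t)).hasDerivAt.fun_pow 2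
    · exact Continuous.intervalIntegrable (by fun_prop) _ _
  have h1 : ∀ t, (m * H t + deriv H t) ^ 2
      = (m ^ 2 * H t ^ 2 + m * (2 * H t * deriv H t)) + deriv H t ^ 2 := fun t => by ring
  simp_rw [h1]
  rw [intervalIntegral.integral_add, intervalIntegral.integral_add,
    intervalIntegral.integral_const_mul, intervalIntegral.integral_const_mul, h0]
  · ring
  all_goals exact Continuous.intervalIntegrable (by fun_prop) _ _

/-- If the one-dimensional energy inequality holds for all smooth functions vanishing near the
endpoints of `(α, β)`, then testing it on sine waves bounds the constant. -/
theorem one_le_of_energy_inequality {c m α β : ℝ} (hαβ : α < β)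
    (h : ∀ H : ℝ → ℝ, ContDiff ℝ (⊤ : ℕ∞) H →
      (∃ δ > 0, ∀ t ∈ Set.Icc α β, t < α + δ ∨ β - δ < t → H t = 0) →
      ∫ t in α..β, H t ^ 2 ≤ c ^ 2 * ∫ t in α..β, (m * H t + deriv H t) ^ 2) :
    1 ≤ c ^ 2 * (m ^ 2 + (Real.pi / (β - α)) ^ 2) := by
  by_contra! hlt
  have hL : 0 < β - α := sub_pos.2 hαβ
  set k := Real.pi / (β - α) with hk
  have hk0 : 0 < k := div_pos Real.pi_pos hL
  have hkL : k * β - k * α = Real.pi := by rw [← mul_sub, hk]; field_simp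
  have key : ∀ ε > 0, (1 - c ^ 2 * m ^ 2) * ((β - α) / 2 - 4 * ε * (β - α))
      ≤ c ^ 2 * (k ^ 2 * ((β - α) / 2)) := by
    intro ε hε
    obtain ⟨H, hH, hH0, hHn, hHl, hHd⟩ := exists_truncated_sin k (k * α) hε
    have hc : Continuous H := hH.continuous
    have hc' : Continuous (deriv H) := hH.continuous_deriv (by simp)
    have hend : ∀ t ∈ Set.Icc α β, t < α + ε / k ∨ β - ε / k < t → H t = 0 := by
      rintro t ⟨ht1, ht2⟩ (ht | ht)
      · refine hH0 t ((Real.sin_le (by nlinarith)).trans ?_)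
        have := (lt_div_iff₀ hk0).1 (show t - α < ε / k by linarith)
        nlinarith
      · refine hH0 t ?_
        rw [← Real.sin_pi_sub]
        refine (Real.sin_le (by nlinarith)).trans ?_
        have := (lt_div_iff₀ hk0).1 (show β - t < ε / k by linarith)
        nlinarith
    have hδ : 0 < ε / k := by positivity
    have h1 := h H hH ⟨ε / k, hδ, hend⟩
    rw [integral_sq_const_mul_add_deriv hH m
      (hend α ⟨le_rfl, hαβ.le⟩ (Or.inl (by linarith)))
      (hend β ⟨hαβ.le, le_rfl⟩ (Or.inr (by linarith)))] at h1
    have hcos : ∫ t in α..β, k ^ 2 * Real.cos (k * t - k * α) ^ 2 = k ^ 2 * ((β - α) / 2) := by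
      rw [intervalIntegral.integral_const_mul,
        intervalIntegral.integral_comp_mul_sub (fun x => Real.cos x ^ 2) hk0.ne', integral_cos_sq,
        hkL, sub_self]
      simp only [hk, Real.sin_pi, Real.sin_zero, smul_eq_mul]
      field_simp
      ring
    have hsin : ∫ t in α..β, (Real.sin (k * t - k * α) ^ 2 - 4 * ε)
        = (β - α) / 2 - 4 * ε * (β - α) := by
      rw [intervalIntegral.integral_sub,
        intervalIntegral.integral_comp_mul_sub (fun x => Real.sin x ^ 2) hk0.ne', integral_sin_sq,
        hkL, sub_self]
      · simp only [hk, Real.sin_pi, Real.sin_zero, smul_eq_mul, intervalIntegral.integral_const]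
        field_simp
        ring
      all_goals exact Continuous.intervalIntegrable (by fun_prop) _ _
    have h2 : ∫ t in α..β, deriv H t ^ 2 ≤ k ^ 2 * ((β - α) / 2) := by
      rw [← hcos]
      refine intervalIntegral.integral_mono_on hαβ.le ?_ ?_ fun t _ => hHd t
      all_goals exact Continuous.intervalIntegrable (by fun_prop) _ _
    have h3 : (β - α) / 2 - 4 * ε * (β - α) ≤ ∫ t in α..β, H t ^ 2 := by
      rw [← hsin]
      refine intervalIntegral.integral_mono_on hαβ.le ?_ ?_ fun t ht => ?_
      · exact Continuous.intervalIntegrable (by fun_prop) _ _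
      · exact Continuous.intervalIntegrable (by fun_prop) _ _
      have hs0 : 0 ≤ Real.sin (k * t - k * α) :=
        Real.sin_nonneg_of_nonneg_of_le_pi (by nlinarith [ht.1]) (by nlinarith [ht.2])
      have hs1 := Real.sin_le_one (k * t - k * α)
      have hl := hHl t
      have hn := hHn t
      generalize Real.sin (k * t - k * α) = s at hs0 hs1 hl ⊢
      rcases le_or_gt (2 * ε) s with hs | hs
      · nlinarith
      · nlinarith
    have hm : 0 < 1 - c ^ 2 * m ^ 2 := by nlinarith [mul_nonneg (sq_nonneg c) (sq_nonneg k)]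
    nlinarith [mul_le_mul_of_nonneg_left h2 (sq_nonneg c), mul_le_mul_of_nonneg_left h3 hm.le]
  set A := 1 - c ^ 2 * m ^ 2 with hA
  set D := A - c ^ 2 * k ^ 2 with hD
  have hDpos : 0 < D := by rw [hD, hA]; linarith
  have hApos : 0 < A := by nlinarith [mul_nonneg (sq_nonneg c) (sq_nonneg k)]
  have h4 := key (D / (16 * A)) (by positivity)
  have h5 : A * ((β - α) / 2 - 4 * (D / (16 * A)) * (β - α))
      = (β - α) * (A / 2 - D / 4) := by field_simp; ring
  rw [h5] at h4
  nlinarith [mul_pos hL hDpos]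

theorem tsupport_indicator_subset_Icc {f : ℝ → ℝ} {a b a' b' : ℝ}
    (h0 : ∀ y ∈ Set.Ioo a b, y ∉ Set.Icc a' b' → f y = 0) :
    tsupport ((Set.Ioo a b).indicator f) ⊆ Set.Icc a' b' := by
  refine closure_minimal (fun y hy => ?_) isClosed_Icc
  by_contra hn
  refine hy ?_
  by_cases hab : y ∈ Set.Ioo a b
  · rw [Set.indicator_of_mem hab, h0 y hab hn]
  · exact Set.indicator_of_notMem hab _

theorem contDiff_indicator_Ioo {f : ℝ → ℝ} {a b a' b' : ℝ} (ha : a < a') (hb : b' < b)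
    (hf : ∀ y ∈ Set.Ioo a b, ContDiffAt ℝ (⊤ : ℕ∞) f y)
    (h0 : ∀ y ∈ Set.Ioo a b, y ∉ Set.Icc a' b' → f y = 0) :
    ContDiff ℝ (⊤ : ℕ∞) ((Set.Ioo a b).indicator f) := by
  refine contDiff_iff_contDiffAt.2 fun y => ?_
  by_cases hy : y ∈ Set.Ioo a b
  · refine (hf y hy).congr_of_eventuallyEq ?_
    filter_upwards [isOpen_Ioo.mem_nhds hy] with z hz using Set.indicator_of_mem hz _
  · have hy' : y ∉ tsupport ((Set.Ioo a b).indicator f) := fun h =>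
      hy ((Set.Icc_subset_Ioo ha hb) (tsupport_indicator_subset_Icc h0 h))
    exact contDiffAt_const.congr_of_eventuallyEq (notMem_tsupport_iff_eventuallyEq.1 hy')

/-- The substitution `g y = y ^ ((1 + γ) / 2) * H (log y)` turns the weighted Hardy inequality on
`(a, b)` into an unweighted energy inequality on `(log a, log b)`. -/
theorem energy_inequality_of_hardy {γ c a b : ℝ} (ha : 0 < a) (hab : a < b)
    (h : ∀ g : ℝ → ℝ, ContDiff ℝ (⊤ : ℕ∞) g → HasCompactSupport g → tsupport g ⊆ Set.Ioo a b →
      ∫ y in Set.Ioo a b, (g y / y) ^ 2 * y ^ (-γ)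
        ≤ c ^ 2 * ∫ y in Set.Ioo a b, (deriv g y) ^ 2 * y ^ (-γ))
    {H : ℝ → ℝ} (hH : ContDiff ℝ (⊤ : ℕ∞) H)
    (hH0 : ∃ δ > 0, ∀ t ∈ Set.Icc (Real.log a) (Real.log b),
      t < Real.log a + δ ∨ Real.log b - δ < t → H t = 0) :
    ∫ t in Real.log a..Real.log b, H t ^ 2
      ≤ c ^ 2 * ∫ t in Real.log a..Real.log b, ((1 + γ) / 2 * H t + deriv H t) ^ 2 := by
  obtain ⟨δ, hδ, hH0⟩ := hH0
  have hb : 0 < b := ha.trans hab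
  set m := (1 + γ) / 2 with hm
  set f : ℝ → ℝ := fun y => y ^ m * H (Real.log y) with hf
  have ha' : a < Real.exp (Real.log a + δ) := by
    rw [← Real.log_lt_iff_lt_exp ha]; linarith
  have hb' : Real.exp (Real.log b - δ) < b := by
    rw [← Real.lt_log_iff_exp_lt hb]; linarith
  have hf0 : ∀ y ∈ Set.Ioo a b,
      y ∉ Set.Icc (Real.exp (Real.log a + δ)) (Real.exp (Real.log b - δ)) → f y = 0 := by
    intro y hy hn
    have hy0 : 0 < y := ha.trans hy.1
    rw [Set.mem_Icc, not_and_or, not_le, not_le, ← Real.log_lt_iff_lt_exp hy0,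
      ← Real.lt_log_iff_exp_lt hy0] at hn
    simp [hf, hH0 (Real.log y) ⟨Real.log_le_log ha hy.1.le, Real.log_le_log hy0 hy.2.le⟩ hn]
  have hfs : ∀ y ∈ Set.Ioo a b, ContDiffAt ℝ (⊤ : ℕ∞) f y := fun y hy => by
    have hy0 : y ≠ 0 := (ha.trans hy.1).ne'
    exact (contDiffAt_id.rpow_const_of_ne hy0).mul
      (hH.contDiffAt.comp y (Real.contDiffAt_log.2 hy0))
  have hts := tsupport_indicator_subset_Icc hf0
  have h1 := h _ (contDiff_indicator_Ioo ha' hb' hfs hf0)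
    (isCompact_Icc.of_isClosed_subset (isClosed_tsupport _) hts)
    (hts.trans (Set.Icc_subset_Ioo ha' hb'))
  have hpow : ∀ y : ℝ, 0 < y → (y ^ m * y⁻¹) ^ 2 * y ^ (-γ) = y⁻¹ := by
    intro y hy
    rw [← Real.rpow_neg_one y, ← Real.rpow_add hy, ← Real.rpow_natCast, ← Real.rpow_mul hy.le,
      ← Real.rpow_add hy]
    congr 1
    rw [hm]; push_cast; ring
  have hsubst : ∀ F : ℝ → ℝ, Continuous F →
      ∫ y in Set.Ioo a b, F (Real.log y) * y⁻¹ = ∫ t in Real.log a..Real.log b, F t := by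
    intro F hF
    have hpos : ∀ x ∈ Set.uIcc a b, x ≠ 0 := fun x hx => by
      rw [Set.uIcc_of_le hab.le] at hx; exact (ha.trans_le hx.1).ne'
    rw [← integral_Ioc_eq_integral_Ioo, ← intervalIntegral.integral_of_le hab.le]
    exact intervalIntegral.integral_comp_mul_deriv (fun x hx => Real.hasDerivAt_log (hpos x hx))
      (continuousOn_id.inv₀ hpos) hF
  have hc : Continuous H := hH.continuous
  have hc' : Continuous (deriv H) := hH.continuous_deriv (by simp)
  rw [← hsubst (fun t => H t ^ 2) (by fun_prop),
    ← hsubst (fun t => (m * H t + deriv H t) ^ 2) (by fun_prop)]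
  refine (le_of_eq ?_).trans (h1.trans (le_of_eq ?_))
  · refine setIntegral_congr_fun measurableSet_Ioo fun y hy => ?_
    simp only [Set.indicator_of_mem hy, hf]
    rw [← hpow y (ha.trans hy.1)]
    ring
  · congr 1
    refine setIntegral_congr_fun measurableSet_Ioo fun y hy => ?_
    have hy0 : 0 < y := ha.trans hy.1
    have hd : HasDerivAt f (m * y ^ (m - 1) * H (Real.log y)
        + y ^ m * (deriv H (Real.log y) * y⁻¹)) y :=
      (Real.hasDerivAt_rpow_const (Or.inl hy0.ne')).mul
        (((hH.differentiable (by simp)).differentiableAt.hasDerivAt).comp y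
          (Real.hasDerivAt_log hy0.ne'))
    have he : (Set.Ioo a b).indicator f =ᶠ[nhds y] f := by
      filter_upwards [isOpen_Ioo.mem_nhds hy] with z hz using Set.indicator_of_mem hz _
    rw [he.deriv_eq, hd.deriv, Real.rpow_sub_one hy0.ne']
    linear_combination (m * H (Real.log y) + deriv H (Real.log y)) ^ 2 * hpow y hy0

/-- Testing the Hardy inequality on products reduces it to one dimension. -/
theorem hardy_interval_of_box {n : ℕ} {γ c : ℝ} {G : Set ((Fin n → ℝ) × ℝ)}
    (hineq : ∀ ψ : (Fin n → ℝ) × ℝ → ℝ, ContDiff ℝ (⊤ : ℕ∞) ψ → HasCompactSupport ψ →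
      tsupport ψ ⊆ G →
      ∫ x in G, (ψ x / x.2) ^ 2 * x.2 ^ (-γ)
        ≤ c ^ 2 * ∫ x in G, (fderiv ℝ ψ x (0, 1)) ^ 2 * x.2 ^ (-γ))
    {U : Set (Fin n → ℝ)} (hU : IsOpen U) (hne : U.Nonempty) {a b : ℝ}
    (hbox : U ×ˢ Set.Ioo a b ⊆ G) {g : ℝ → ℝ} (hg : ContDiff ℝ (⊤ : ℕ∞) g)
    (hgc : HasCompactSupport g) (hgs : tsupport g ⊆ Set.Ioo a b) :
    ∫ y in Set.Ioo a b, (g y / y) ^ 2 * y ^ (-γ)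
      ≤ c ^ 2 * ∫ y in Set.Ioo a b, (deriv g y) ^ 2 * y ^ (-γ) := by
  obtain ⟨x₀, hx₀⟩ := hne
  obtain ⟨χ, hχs, hχc, hχ, -, hχ1⟩ :=
    exists_contDiff_tsupport_subset (n := ⊤) (hU.mem_nhds hx₀)
  set ψ : (Fin n → ℝ) × ℝ → ℝ := fun x => χ x.1 * g x.2 with hψ
  have hts : tsupport ψ ⊆ tsupport χ ×ˢ tsupport g := by
    refine closure_minimal (fun x hx => ?_) ((isClosed_tsupport _).prod (isClosed_tsupport _))
    exact ⟨subset_tsupport _ (left_ne_zero_of_mul hx), subset_tsupport _ (right_ne_zero_of_mul hx)⟩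
  have hsub : tsupport χ ×ˢ tsupport g ⊆ G := (Set.prod_mono hχs hgs).trans hbox
  have h1 := hineq ψ ((hχ.comp contDiff_fst).mul (hg.comp contDiff_snd))
    ((hχc.isCompact.prod hgc.isCompact).of_isClosed_subset (isClosed_tsupport _) hts)
    (hts.trans hsub)
  have hfd : ∀ x, fderiv ℝ ψ x (0, 1) = χ x.1 * deriv g x.2 := by
    intro x
    have hdχ : HasFDerivAt (fun x : (Fin n → ℝ) × ℝ => χ x.1) _ x :=
      ((hχ.differentiable (by simp)).differentiableAt (x := x.1)).hasFDerivAt.comp x hasFDerivAt_fst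
    have hdg : HasFDerivAt (fun x : (Fin n → ℝ) × ℝ => g x.2) _ x :=
      ((hg.differentiable (by simp)).differentiableAt (x := x.2)).hasFDerivAt.comp x hasFDerivAt_snd
    rw [hψ, (hdχ.fun_mul hdg).fderiv]
    simp
  have hsplit : ∀ w : ℝ → ℝ, (∀ y ∉ tsupport g, w y = 0) →
      ∫ x in G, (χ x.1) ^ 2 * w x.2 = (∫ x, χ x ^ 2) * ∫ y in Set.Ioo a b, w y := by
    intro w hw
    rw [setIntegral_eq_integral_of_forall_compl_eq_zero,
      setIntegral_eq_integral_of_forall_compl_eq_zero, Measure.volume_eq_prod]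
    · exact integral_prod_mul (fun x => χ x ^ 2) w
    · exact fun y hy => hw y fun h => hy (hgs h)
    · intro x hx
      by_cases hx1 : x.1 ∈ tsupport χ
      · rw [hw x.2 fun hx2 => hx (hsub ⟨hx1, hx2⟩), mul_zero]
      · simp [image_eq_zero_of_notMem_tsupport hx1]
  have hl : ∀ x : (Fin n → ℝ) × ℝ, (ψ x / x.2) ^ 2 * x.2 ^ (-γ)
      = χ x.1 ^ 2 * ((g x.2 / x.2) ^ 2 * x.2 ^ (-γ)) := fun x => by simp only [hψ]; ring
  have hr : ∀ x : (Fin n → ℝ) × ℝ, (fderiv ℝ ψ x (0, 1)) ^ 2 * x.2 ^ (-γ)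
      = χ x.1 ^ 2 * ((deriv g x.2) ^ 2 * x.2 ^ (-γ)) := fun x => by rw [hfd]; ring
  simp_rw [hl, hr] at h1
  rw [hsplit (fun y => (g y / y) ^ 2 * y ^ (-γ)), hsplit (fun y => (deriv g y) ^ 2 * y ^ (-γ))]
    at h1
  · have hpos : 0 < ∫ x, χ x ^ 2 := by
      refine Continuous.integral_pos_of_hasCompactSupport_nonneg_nonzero (x := x₀)
        (hχ.continuous.pow 2) ?_ (fun x => sq_nonneg _) (by simp [hχ1])
      exact hχc.comp_left (g := fun t : ℝ => t ^ 2) (by simp)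
    refine le_of_mul_le_mul_left (h1.trans_eq ?_) hpos
    ring
  · intro y hy
    simp [image_eq_zero_of_notMem_tsupport fun h => hy (tsupport_deriv_subset h)]
  · intro y hy
    simp [image_eq_zero_of_notMem_tsupport hy]

/-- Lemma 3.2 (box criterion): lower bounds on any admissible constant `c` in the weighted
Hardy inequality on a domain `G` in the half-space, in terms of boxes contained in `G`. -/
theorem lemma_3_2 (n : ℕ) (hn : 1 ≤ n) (γ : ℝ) (hγ : γ ≠ -1)
    (G : Set ((Fin n → ℝ) × ℝ)) (hGo : IsOpen G) (hGs : G ⊆ halfSpace n)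
    (c : ℝ) (hc : 0 < c)
    (hineq : ∀ ψ : (Fin n → ℝ) × ℝ → ℝ, ContDiff ℝ (⊤ : ℕ∞) ψ → HasCompactSupport ψ →
      tsupport ψ ⊆ G →
      ∫ x in G, (ψ x / x.2) ^ 2 * x.2 ^ (-γ)
        ≤ c ^ 2 * ∫ x in G, (fderiv ℝ ψ x (0, 1)) ^ 2 * x.2 ^ (-γ)) :
    (∀ (lo hi : Fin n → ℝ) (a b : ℝ), (∀ i, lo i < hi i) → 0 < a → a < b →
      (openBox n lo hi) ×ˢ Set.Ioo a b ⊆ G →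
      c ≥ (((1 + γ) / 2) ^ 2 + (Real.pi / Real.log (b / a)) ^ 2) ^ (-(1/2 : ℝ))) ∧
    (∀ (lo hi : Fin n → ℝ) (b : ℝ), (∀ i, lo i < hi i) → 0 < b →
      (openBox n lo hi) ×ˢ Set.Ioo 0 b ⊆ G →
      c ≥ 2 / |1 + γ|) := by
  have hU : ∀ lo hi : Fin n → ℝ, IsOpen (openBox n lo hi) := fun lo hi =>
    isOpen_set_pi Set.finite_univ fun i _ => isOpen_Ioo
  have hi : ∀ (lo hi : Fin n → ℝ) (a b : ℝ), (∀ i, lo i < hi i) → 0 < a → a < b →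
      (openBox n lo hi) ×ˢ Set.Ioo a b ⊆ G →
      c ≥ (((1 + γ) / 2) ^ 2 + (Real.pi / Real.log (b / a)) ^ 2) ^ (-(1/2 : ℝ)) := by
    intro lo hi a b hlh ha hab hbox
    have hne : (openBox n lo hi).Nonempty :=
      Set.univ_pi_nonempty_iff.2 fun i => Set.nonempty_Ioo.2 (hlh i)
    have h1 := one_le_of_energy_inequality (Real.log_lt_log ha hab) fun H hH hH0 =>
      energy_inequality_of_hardy ha hab
        (fun g hg hgc hgs => hardy_interval_of_box hineq (hU lo hi) hne hbox hg hgc hgs) hH hH0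
    rw [← Real.log_div (ha.trans hab).ne' ha.ne'] at h1
    have hm : (1 + γ) / 2 ≠ 0 := fun h => hγ (by linarith)
    set E := ((1 + γ) / 2) ^ 2 + (Real.pi / Real.log (b / a)) ^ 2
    have hE : 0 < E := by positivity
    rw [ge_iff_le, Real.rpow_neg hE.le, ← Real.sqrt_eq_rpow,
      inv_le_iff_one_le_mul₀ (Real.sqrt_pos.2 hE), ← Real.sqrt_sq hc.le,
      ← Real.sqrt_mul (sq_nonneg c), Real.one_le_sqrt]
    exact h1
  refine ⟨hi, fun lo hi' b hlh hb hbox => ?_⟩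
  have hm : (1 + γ) / 2 ≠ 0 := fun h => hγ (by linarith)
  have hlim : Filter.Tendsto (fun s : ℝ =>
      (((1 + γ) / 2) ^ 2 + (Real.pi / s) ^ 2) ^ (-(1/2 : ℝ))) Filter.atTop
      (nhds ((((1 + γ) / 2) ^ 2 + 0 ^ 2) ^ (-(1/2 : ℝ)))) :=
    (tendsto_const_nhds.add ((Filter.tendsto_id.const_div_atTop Real.pi).pow 2)).rpow_const
      (Or.inl (by positivity))
  have hval : (((1 + γ) / 2) ^ 2 + 0 ^ 2) ^ (-(1/2 : ℝ)) = 2 / |1 + γ| := by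
    rw [zero_pow two_ne_zero, add_zero, Real.rpow_neg (sq_nonneg _), ← Real.sqrt_eq_rpow,
      Real.sqrt_sq_eq_abs, abs_div, abs_two, inv_div]
  rw [hval] at hlim
  refine le_of_tendsto hlim ?_
  filter_upwards [Filter.eventually_gt_atTop 0] with s hs
  have hlt : b * Real.exp (-s) < b := by
    have : Real.exp (-s) < 1 := by simpa using hs
    nlinarith
  have h2 := hi lo hi' (b * Real.exp (-s)) b hlh (by positivity) hlt
    ((Set.prod_mono subset_rfl (Set.Ioo_subset_Ioo_left (by positivity))).trans hbox)
  have hlog : Real.log (b / (b * Real.exp (-s))) = s := by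
    rw [div_mul_cancel_left₀ hb.ne', ← Real.exp_neg, Real.log_exp, neg_neg]
  rwa [hlog] at h2
end
end

section
/- Let 0 < a < b and γ ∈ ℝ, and set λ_min := ((1+γ)/2)² + (π/ln(b/a))². Then: (i) for every continuously differentiable f : [a,b] → ℝ with f(a) = f(b) = 0, ∫_a^b f'(y)² y^{-γ} dy ≥ λ_min · ∫_a^b (f(y)/y)² y^{-γ} dy; (ii) equality holds for the function f_min(y) := y^{(1+γ)/2} · sin(π · ln(y/a)/ln(b/a)), i.e. ∫_a^b f_min'(y)² y^{-γ} dy = λ_min · ∫_a^b (f_min(y)/y)² y^{-γ} dy. (Sharp one-dimensional weighted Hardy inequality on an interval, from the proof of Lemma 3.2) -/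
open MeasureTheory

noncomputable section

/-- The weighted Hardy inequality with a subcritical frequency `θ < π / log (b / a)`, for which
`(((1 + γ) / 2) - θ tan (θ (log y - m))) / y`, with `m` the midpoint of `log a` and `log b`, is a
regular solution of the associated Riccati equation on `[a, b]`. -/
theorem weighted_hardy_of_subcritical {a b γ θ : ℝ} (ha : 0 < a) (hab : a < b) (hθ : 0 ≤ θ)
    (hθL : θ * (Real.log b - Real.log a) < Real.pi) {f f' : ℝ → ℝ}
    (hf : ∀ y ∈ Set.Icc a b, HasDerivAt f (f' y) y) (hf' : ContinuousOn f' (Set.Icc a b))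
    (hfa : f a = 0) (hfb : f b = 0) :
    (((1 + γ) / 2) ^ 2 + θ ^ 2) * ∫ y in Set.Ioo a b, (f y / y) ^ 2 * y ^ (-γ) ≤
      ∫ y in Set.Ioo a b, (f' y) ^ 2 * y ^ (-γ) := by
  have hpos : ∀ y ∈ Set.Icc a b, 0 < y := fun y hy => ha.trans_le hy.1
  have hw : ContinuousOn (fun y : ℝ => y ^ (-γ)) (Set.Icc a b) :=
    continuousOn_id.rpow_const fun y hy => Or.inl (hpos y hy).ne'
  have hfc : ContinuousOn f (Set.Icc a b) := fun y hy => (hf y hy).continuousAt.continuousWithinAt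
  have hl : IntegrableOn (fun y => (f' y) ^ 2 * y ^ (-γ)) (Set.Icc a b) :=
    ((hf'.pow 2).mul hw).integrableOn_Icc
  have hr : IntegrableOn (fun y => (f y / y) ^ 2 * y ^ (-γ)) (Set.Icc a b) :=
    (((hfc.div continuousOn_id fun y hy => (hpos y hy).ne').pow 2).mul hw).integrableOn_Icc
  set lam := ((1 + γ) / 2) ^ 2 + θ ^ 2 with hlam
  set m := (Real.log a + Real.log b) / 2 with hm
  set q : ℝ → ℝ := fun y => (1 + γ) / 2 - θ * Real.tan (θ * (Real.log y - m)) with hq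
  have hcos : ∀ y ∈ Set.Icc a b, Real.cos (θ * (Real.log y - m)) ≠ 0 := by
    intro y hy
    have h1 : Real.log a ≤ Real.log y := Real.log_le_log ha hy.1
    have h2 : Real.log y ≤ Real.log b := Real.log_le_log (hpos y hy) hy.2
    refine (Real.cos_pos_of_mem_Ioo ⟨?_, ?_⟩).ne'
    · nlinarith [mul_le_mul_of_nonneg_left h1 hθ]
    · nlinarith [mul_le_mul_of_nonneg_left h2 hθ]
  have hG : ∀ y ∈ Set.Icc a b, HasDerivAt (fun y => q y * (y ^ (-γ) / y) * f y ^ 2)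
      ((f' y) ^ 2 * y ^ (-γ) - lam * ((f y / y) ^ 2 * y ^ (-γ))
        - (f' y - q y / y * f y) ^ 2 * y ^ (-γ)) y := by
    intro y hy
    have hy0 := (hpos y hy).ne'
    have hqd : HasDerivAt q
        (-(θ * ((1 + Real.tan (θ * (Real.log y - m)) ^ 2) * (θ * y⁻¹)))) y := by
      have h := ((((Real.hasDerivAt_tan (hcos y hy)).comp y
        (((Real.hasDerivAt_log hy0).sub_const m).const_mul θ))).const_mul θ).const_sub ((1 + γ) / 2)
      rw [one_div, ← Real.inv_one_add_tan_sq (hcos y hy), inv_inv] at h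
      exact h
    have hwd : HasDerivAt (fun y : ℝ => y ^ (-γ)) (-γ * (y ^ (-γ) / y)) y := by
      rw [← Real.rpow_sub_one hy0]
      exact Real.hasDerivAt_rpow_const (Or.inl hy0)
    refine ((hqd.mul (hwd.div (hasDerivAt_id y) hy0)).mul ((hf y hy).pow 2)).congr_deriv ?_
    simp only [hq, hlam, id, Pi.mul_apply, Pi.div_apply, Pi.pow_apply]
    field_simp
    ring
  have key := intervalIntegral.sub_le_integral_of_hasDeriv_right_of_le hab.le
    (fun y hy => (hG y hy).continuousAt.continuousWithinAt)
    (fun y hy => (hG y (Set.Ioo_subset_Icc_self hy)).hasDerivWithinAt)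
    (hl.sub (hr.const_mul lam)) (fun y hy => by
      have := (Real.rpow_pos_of_pos (hpos y (Set.Ioo_subset_Icc_self hy)) (-γ)).le
      exact sub_le_self _ (by positivity))
  rw [intervalIntegral.integral_of_le hab.le, integral_Ioc_eq_integral_Ioo] at key
  simp only [Pi.sub_apply] at key
  rw [integral_sub (hl.mono_set Set.Ioo_subset_Icc_self)
    ((hr.mono_set Set.Ioo_subset_Icc_self).const_mul lam), integral_const_mul, hfa, hfb] at key
  linarith

/-- The function `y ^ ((1 + γ) / 2) * sin (π log (y / a) / log (b / a))` attains equality in the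
weighted Hardy inequality on `(a, b)`. -/
theorem weighted_hardy_extremal_eq {a b γ : ℝ} (ha : 0 < a) (hab : a < b) :
    (∫ y in Set.Ioo a b,
        (deriv (fun y : ℝ =>
          y ^ ((1 + γ) / 2) * Real.sin (Real.pi * Real.log (y / a) / Real.log (b / a))) y) ^ 2
          * y ^ (-γ))
      = (((1 + γ) / 2) ^ 2 + (Real.pi / Real.log (b / a)) ^ 2) *
        ∫ y in Set.Ioo a b,
          ((y ^ ((1 + γ) / 2) * Real.sin (Real.pi * Real.log (y / a) / Real.log (b / a))) / y) ^ 2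
            * y ^ (-γ) := by
  set p := (1 + γ) / 2 with hp
  set L := Real.log (b / a) with hL
  set ω := Real.pi / L with hω
  have hL0 : L ≠ 0 := (Real.log_pos ((one_lt_div ha).2 hab)).ne'
  have hpos : ∀ y ∈ Set.Icc a b, 0 < y := fun y hy => ha.trans_le hy.1
  set t : ℝ → ℝ := fun y => Real.pi * Real.log (y / a) / L with ht
  have htd : ∀ y ∈ Set.Icc a b, HasDerivAt t (ω / y) y := by
    intro y hy
    have hy0 := (hpos y hy).ne'
    refine (((((hasDerivAt_id y).div_const a).log
      (div_ne_zero hy0 ha.ne')).const_mul Real.pi).div_const L).congr_deriv ?_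
    simp only [hω, id]
    field_simp
  have htc : ContinuousOn t (Set.Icc a b) := fun y hy => (htd y hy).continuousAt.continuousWithinAt
  have hsc := Real.continuous_sin.comp_continuousOn htc
  have hcc := Real.continuous_cos.comp_continuousOn htc
  have hic : ContinuousOn (fun y : ℝ => y⁻¹) (Set.Icc a b) :=
    continuousOn_id.inv₀ fun y hy => (hpos y hy).ne'
  have hw : ∀ y : ℝ, 0 < y → (y ^ p) ^ 2 * y ^ (-γ) = y := by
    intro y hy
    rw [← Real.rpow_natCast, ← Real.rpow_mul hy.le, ← Real.rpow_add hy]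
    convert Real.rpow_one y using 2
    simp only [hp]
    push_cast
    ring
  have hl : Set.EqOn
      (fun y => (deriv (fun y : ℝ => y ^ p * Real.sin (t y)) y) ^ 2 * y ^ (-γ))
      (fun y => (p * Real.sin (t y) + ω * Real.cos (t y)) ^ 2 * y⁻¹) (Set.Ioo a b) := by
    intro y hy
    have hy' := Set.Ioo_subset_Icc_self hy
    have hy0 := (hpos y hy').ne'
    have hd : HasDerivAt (fun y : ℝ => y ^ p * Real.sin (t y))
        (y ^ p * (p * Real.sin (t y) + ω * Real.cos (t y)) / y) y := by
      have h := Real.hasDerivAt_rpow_const (x := y) (p := p) (Or.inl hy0)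
      rw [Real.rpow_sub_one hy0] at h
      refine (h.mul (htd y hy').sin).congr_deriv ?_
      field_simp
    simp only [hd.deriv]
    calc _ = ((y ^ p) ^ 2 * y ^ (-γ)) * (p * Real.sin (t y) + ω * Real.cos (t y)) ^ 2 / y ^ 2 := by
          ring
      _ = _ := by
          rw [hw y (hpos y hy')]
          field_simp
  have hr : Set.EqOn (fun y => (y ^ p * Real.sin (t y) / y) ^ 2 * y ^ (-γ))
      (fun y => Real.sin (t y) ^ 2 * y⁻¹) (Set.Ioo a b) := by
    intro y hy
    have hy' := Set.Ioo_subset_Icc_self hy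
    have hy0 := (hpos y hy').ne'
    calc _ = ((y ^ p) ^ 2 * y ^ (-γ)) * Real.sin (t y) ^ 2 / y ^ 2 := by ring
      _ = _ := by
          rw [hw y (hpos y hy')]
          field_simp
  have hli : IntervalIntegrable
      (fun y => (p * Real.sin (t y) + ω * Real.cos (t y)) ^ 2 * y⁻¹) volume a b :=
    (((((hsc.const_mul p).add (hcc.const_mul ω)).pow 2).mul hic).intervalIntegrable_of_Icc hab.le)
  have hri : IntervalIntegrable (fun y => Real.sin (t y) ^ 2 * y⁻¹) volume a b :=
    ((hsc.pow 2).mul hic).intervalIntegrable_of_Icc hab.le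
  have hG : ∀ y ∈ Set.uIcc a b, HasDerivAt
      (fun y => p * Real.sin (t y) ^ 2 + ω * (Real.sin (t y) * Real.cos (t y)))
      ((p * Real.sin (t y) + ω * Real.cos (t y)) ^ 2 * y⁻¹
        - (p ^ 2 + ω ^ 2) * (Real.sin (t y) ^ 2 * y⁻¹)) y := by
    intro y hy
    rw [Set.uIcc_of_le hab.le] at hy
    have h := htd y hy
    refine (((h.sin.pow 2).const_mul p).add ((h.sin.mul h.cos).const_mul ω)).congr_deriv ?_
    simp only [div_eq_mul_inv]
    ring
  have key := intervalIntegral.integral_eq_sub_of_hasDerivAt hG (hli.sub (hri.const_mul _))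
  have hta : t a = 0 := by simp [ht, ha.ne']
  have htb : t b = Real.pi := by
    simp only [ht, ← hL]
    field_simp
  rw [intervalIntegral.integral_sub hli (hri.const_mul _), intervalIntegral.integral_const_mul,
    intervalIntegral.integral_of_le hab.le, intervalIntegral.integral_of_le hab.le,
    integral_Ioc_eq_integral_Ioo, integral_Ioc_eq_integral_Ioo, hta, htb] at key
  simp only [Real.sin_pi, Real.sin_zero] at key
  rw [setIntegral_congr_fun measurableSet_Ioo hl, setIntegral_congr_fun measurableSet_Ioo hr]
  linarith

/-- Sharp one-dimensional weighted Hardy inequality on an interval `(a,b) ⊂ (0,∞)`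
(from the proof of Lemma 3.2): the optimal constant `λ_min` and its attainment by
`f_min(y) = y^{(1+γ)/2} sin(π log(y/a)/log(b/a))`. -/
theorem sharp_1d_hardy (a b γ : ℝ) (ha : 0 < a) (hab : a < b) :
    (∀ f f' : ℝ → ℝ, (∀ y ∈ Set.Icc a b, HasDerivAt f (f' y) y) →
      ContinuousOn f' (Set.Icc a b) → f a = 0 → f b = 0 →
      ∫ y in Set.Ioo a b, (f' y) ^ 2 * y ^ (-γ)
        ≥ (((1 + γ) / 2) ^ 2 + (Real.pi / Real.log (b / a)) ^ 2) *
            ∫ y in Set.Ioo a b, (f y / y) ^ 2 * y ^ (-γ)) ∧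
    ((∫ y in Set.Ioo a b,
        (deriv (fun y : ℝ =>
          y ^ ((1 + γ) / 2) * Real.sin (Real.pi * Real.log (y / a) / Real.log (b / a))) y) ^ 2
          * y ^ (-γ))
      = (((1 + γ) / 2) ^ 2 + (Real.pi / Real.log (b / a)) ^ 2) *
        ∫ y in Set.Ioo a b,
          ((y ^ ((1 + γ) / 2) * Real.sin (Real.pi * Real.log (y / a) / Real.log (b / a))) / y) ^ 2
            * y ^ (-γ)) := by
  refine ⟨fun f f' hf hf' hfa hfb => ?_, weighted_hardy_extremal_eq ha hab⟩
  have hL : 0 < Real.log (b / a) := Real.log_pos ((one_lt_div ha).2 hab)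
  have hω : 0 < Real.pi / Real.log (b / a) := div_pos Real.pi_pos hL
  have hlim : Filter.Tendsto (fun θ : ℝ => (((1 + γ) / 2) ^ 2 + θ ^ 2) *
      ∫ y in Set.Ioo a b, (f y / y) ^ 2 * y ^ (-γ))
      (nhdsWithin (Real.pi / Real.log (b / a)) (Set.Iio (Real.pi / Real.log (b / a))))
      (nhds ((((1 + γ) / 2) ^ 2 + (Real.pi / Real.log (b / a)) ^ 2) *
        ∫ y in Set.Ioo a b, (f y / y) ^ 2 * y ^ (-γ))) :=
    (Continuous.tendsto (by fun_prop) _).mono_left nhdsWithin_le_nhds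
  refine le_of_tendsto hlim ?_
  filter_upwards [Ioo_mem_nhdsLT hω] with θ hθ
  refine weighted_hardy_of_subcritical ha hab hθ.1.le ?_ hf hf' hfa hfb
  rw [← Real.log_div (ha.trans hab).ne' ha.ne']
  exact (lt_div_iff₀ hL).1 hθ.2
end
end

section
/- Let n ≥ 1 be an integer, γ ∈ ℝ with γ ≠ −1, and c ≥ 0. Set C_γ := 1 + |γ/(1+γ)| and C̃_γ := min{1, 1/|1+γ|}. Then for every smooth ψ : ℝⁿ × ℝ → ℝ with compact support contained in the half-space {y > 0}: C̃_γ · ‖∇_c ψ‖_γ ≤ ‖∇_c (y^{-γ/2} ψ)‖_0 ≤ C_γ · ‖∇_c ψ‖_γ, where ‖∇_c g‖_β² := ∫ (c²|∇_x g|² + |∂_y g|²) y^{-β} dx dy (integral over the half-space) and ‖·‖_0 is the case β = 0. (Lemma 3.3, equivalence of weighted gradient norms) -/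
open MeasureTheory

noncomputable section

/-- The squared weighted gradient norm `‖∇_c f‖_β² = ∫ (c²|∇_x f|² + |∂_y f|²) y^{-β}`. -/
def gradNormSq (n : ℕ) (c β : ℝ) (f : (Fin n → ℝ) × ℝ → ℝ) : ℝ :=
  ∫ x in halfSpace n,
    (c ^ 2 * ∑ i : Fin n, (fderiv ℝ f x (Pi.single i 1, 0)) ^ 2
      + (fderiv ℝ f x (0, 1)) ^ 2) * x.2 ^ (-β)

/-- Multiplication by a power of the last coordinate preserves `C^k` regularity of functions
supported in the open half-space. -/
theorem contDiff_rpow_mul {n : ℕ} {k : ℕ∞} {g : (Fin n → ℝ) × ℝ → ℝ} (a : ℝ)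
    (hg : ContDiff ℝ k g) (hgs : tsupport g ⊆ halfSpace n) :
    ContDiff ℝ k (fun x : (Fin n → ℝ) × ℝ => x.2 ^ a * g x) := by
  rw [contDiff_iff_contDiffAt]
  intro x
  by_cases hx : x ∈ tsupport g
  · have hx2 : x.2 ≠ 0 := (hgs hx).ne'
    exact (contDiffAt_snd.rpow_const_of_ne hx2).mul hg.contDiffAt
  · have h0 : (fun x : (Fin n → ℝ) × ℝ => x.2 ^ a * g x) =ᶠ[nhds x] fun _ => 0 := by
      filter_upwards [notMem_tsupport_iff_eventuallyEq.mp hx] with z hz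
      simp [hz]
    exact contDiffAt_const.congr_of_eventuallyEq h0

/-- A power of the last coordinate times a continuous function with compact support in the open
half-space is integrable. -/
theorem integrable_rpow_mul {n : ℕ} {g : (Fin n → ℝ) × ℝ → ℝ} (a : ℝ)
    (hg : Continuous g) (hgc : HasCompactSupport g) (hgs : tsupport g ⊆ halfSpace n) :
    Integrable (fun x : (Fin n → ℝ) × ℝ => x.2 ^ a * g x) :=
  (contDiff_rpow_mul (k := 0) a (contDiff_zero.mpr hg) hgs).continuous.integrable_of_hasCompactSupport
    hgc.mul_left

theorem measurableSet_halfSpace (n : ℕ) : MeasurableSet (halfSpace n) :=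
  measurableSet_lt measurable_const measurable_snd

theorem fderiv_rpow_mul {n : ℕ} {g : (Fin n → ℝ) × ℝ → ℝ} (a : ℝ) {x : (Fin n → ℝ) × ℝ}
    (hg : DifferentiableAt ℝ g x) (hx : x ∈ halfSpace n) (v : (Fin n → ℝ) × ℝ) :
    fderiv ℝ (fun x : (Fin n → ℝ) × ℝ => x.2 ^ a * g x) x v
      = x.2 ^ a * (fderiv ℝ g x v + a * v.2 * g x / x.2) := by
  have hx0 : 0 < x.2 := hx
  have h := ((hasFDerivAt_snd (𝕜 := ℝ) (p := x)).rpow_const (p := a) (Or.inl hx0.ne')).mul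
    hg.hasFDerivAt
  rw [show (fun x : (Fin n → ℝ) × ℝ => x.2 ^ a * g x)
    = (fun x : (Fin n → ℝ) × ℝ => x.2 ^ a) * g from rfl, h.fderiv]
  simp only [add_apply, smul_apply,
    ContinuousLinearMap.coe_snd', smul_eq_mul, Real.rpow_sub_one hx0.ne']
  ring

/-- The integral over the half-space of a directional derivative of a `C^1` function with compact
support in the half-space vanishes. -/
theorem setIntegral_halfSpace_fderiv_eq_zero {n : ℕ} {F : (Fin n → ℝ) × ℝ → ℝ}
    (hF : ContDiff ℝ 1 F) (hFc : HasCompactSupport F) (hFs : tsupport F ⊆ halfSpace n)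
    (v : (Fin n → ℝ) × ℝ) : ∫ x in halfSpace n, fderiv ℝ F x v = 0 := by
  have hD : Integrable (fun x => fderiv ℝ F x v) :=
    ((hF.continuous_fderiv one_ne_zero).clm_apply
      continuous_const).integrable_of_hasCompactSupport (hFc.fderiv_apply (𝕜 := ℝ) v)
  rw [setIntegral_eq_integral_of_forall_compl_eq_zero]
  · have : (volume : Measure ((Fin n → ℝ) × ℝ)).IsAddHaarMeasure :=
      Measure.prod.instIsAddHaarMeasure _ _
    have h := integral_mul_fderiv_eq_neg_fderiv_mul_of_integrable (𝕜 := ℝ) (μ := volume)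
      (f := fun _ => (1 : ℝ)) (g := F) (v := v) (by simp) (by simpa using hD)
      (by simpa using hF.continuous.integrable_of_hasCompactSupport hFc)
      (by fun_prop) fun x _ => hF.differentiable one_ne_zero x
    simpa using h
  · intro x hx
    rw [fderiv_of_notMem_tsupport (𝕜 := ℝ) fun h => hx (hFs h)]
    rfl

/-- The zeroth order term `∫ ψ² y^{-γ-2}` of the weighted Hardy inequality. -/
def hardyTerm (n : ℕ) (γ : ℝ) (ψ : (Fin n → ℝ) × ℝ → ℝ) : ℝ :=
  ∫ x in halfSpace n, x.2 ^ (-γ - 2) * ψ x ^ 2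

theorem hardyTerm_nonneg (n : ℕ) (γ : ℝ) (ψ : (Fin n → ℝ) × ℝ → ℝ) : 0 ≤ hardyTerm n γ ψ :=
  setIntegral_nonneg (measurableSet_halfSpace n) fun _ hx =>
    mul_nonneg (Real.rpow_nonneg (le_of_lt hx) _) (sq_nonneg _)

theorem gradNormSq_nonneg (n : ℕ) (c β : ℝ) (f : (Fin n → ℝ) × ℝ → ℝ) :
    0 ≤ gradNormSq n c β f :=
  setIntegral_nonneg (measurableSet_halfSpace n) fun _ hx =>
    mul_nonneg (by positivity) (Real.rpow_nonneg (le_of_lt hx) _)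

section CompactlySupported

variable {n : ℕ} {ψ : (Fin n → ℝ) × ℝ → ℝ}

theorem integrable_hardyTerm (γ : ℝ) (hψ : Continuous ψ) (hψc : HasCompactSupport ψ)
    (hψs : tsupport ψ ⊆ halfSpace n) :
    Integrable (fun x : (Fin n → ℝ) × ℝ => x.2 ^ (-γ - 2) * ψ x ^ 2) := by
  simp only [sq]
  exact integrable_rpow_mul _ (hψ.mul hψ) hψc.mul_left ((tsupport_mul_subset_left).trans hψs)

theorem integrable_gradNormSq (c β : ℝ) (hψ : ContDiff ℝ 1 ψ) (hψc : HasCompactSupport ψ)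
    (hψs : tsupport ψ ⊆ halfSpace n) :
    Integrable (fun x : (Fin n → ℝ) × ℝ =>
      (c ^ 2 * ∑ i : Fin n, (fderiv ℝ ψ x (Pi.single i 1, 0)) ^ 2
        + (fderiv ℝ ψ x (0, 1)) ^ 2) * x.2 ^ (-β)) := by
  have hd : ∀ v, Integrable fun x : (Fin n → ℝ) × ℝ => x.2 ^ (-β) * (fderiv ℝ ψ x v) ^ 2 := by
    intro v
    have hv : Continuous fun x => fderiv ℝ ψ x v :=
      (hψ.continuous_fderiv one_ne_zero).clm_apply continuous_const
    simp only [sq]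
    exact integrable_rpow_mul _ (hv.mul hv) (hψc.fderiv_apply (𝕜 := ℝ) v).mul_left
      ((tsupport_mul_subset_left).trans ((tsupport_fderiv_apply_subset ℝ v).trans hψs))
  refine (((integrable_finsetSum Finset.univ fun i _ => hd (Pi.single i 1, 0)).const_mul
    (c ^ 2)).add (hd (0, 1))).congr (Filter.Eventually.of_forall fun x => ?_)
  simp only [Pi.add_apply, ← Finset.mul_sum]
  ring

/-- `∂_y (y^{-γ-1} ψ²)` in expanded form. -/
theorem fderiv_rpow_mul_sq (γ : ℝ) (hψ : Differentiable ℝ ψ) {x : (Fin n → ℝ) × ℝ}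
    (hx : x ∈ halfSpace n) :
    fderiv ℝ (fun x : (Fin n → ℝ) × ℝ => x.2 ^ (-γ - 1) * (ψ x * ψ x)) x (0, 1)
      = x.2 ^ (-γ) * (2 * ψ x * fderiv ℝ ψ x (0, 1) / x.2 - (γ + 1) * ψ x ^ 2 / x.2 ^ 2) := by
  have hx0 : x.2 ≠ 0 := ne_of_gt hx
  rw [fderiv_rpow_mul _ ((hψ x).fun_mul (hψ x)) hx, fderiv_fun_mul (hψ x) (hψ x),
    Real.rpow_sub_one hx0]
  simp only [add_apply, smul_apply, smul_eq_mul]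
  field_simp
  ring

theorem rpow_neg_sub_two (γ : ℝ) {y : ℝ} (hy : 0 < y) : y ^ (-γ - 2) = y ^ (-γ) / y ^ 2 := by
  rw [Real.rpow_sub hy, Real.rpow_ofNat]

theorem setIntegral_fderiv_rpow_mul_sq (γ : ℝ) (hψ : ContDiff ℝ 1 ψ) (hψc : HasCompactSupport ψ)
    (hψs : tsupport ψ ⊆ halfSpace n) :
    IntegrableOn (fderiv ℝ (fun x : (Fin n → ℝ) × ℝ => x.2 ^ (-γ - 1) * (ψ x * ψ x)) · (0, 1))
        (halfSpace n) ∧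
      ∫ x in halfSpace n,
        fderiv ℝ (fun x : (Fin n → ℝ) × ℝ => x.2 ^ (-γ - 1) * (ψ x * ψ x)) x (0, 1) = 0 := by
  have hF : ContDiff ℝ 1 fun x : (Fin n → ℝ) × ℝ => x.2 ^ (-γ - 1) * (ψ x * ψ x) :=
    contDiff_rpow_mul (k := 1) _ (hψ.mul hψ) ((tsupport_mul_subset_left).trans hψs)
  have hFc : HasCompactSupport fun x : (Fin n → ℝ) × ℝ => x.2 ^ (-γ - 1) * (ψ x * ψ x) :=
    HasCompactSupport.mul_left (HasCompactSupport.mul_left hψc)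
  have hFs : tsupport (fun x : (Fin n → ℝ) × ℝ => x.2 ^ (-γ - 1) * (ψ x * ψ x)) ⊆ halfSpace n :=
    (tsupport_mul_subset_right).trans ((tsupport_mul_subset_left).trans hψs)
  exact ⟨(((hF.continuous_fderiv one_ne_zero).clm_apply
    continuous_const).integrable_of_hasCompactSupport
      (hFc.fderiv_apply (𝕜 := ℝ) (0, 1))).integrableOn,
    setIntegral_halfSpace_fderiv_eq_zero hF hFc hFs _⟩

/-- Weighted Hardy inequality: `(1+γ)²/4 ∫ ψ² y^{-γ-2} ≤ ‖∇_c ψ‖_γ²`. -/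
theorem hardy_inequality (c γ : ℝ) (hψ : ContDiff ℝ 1 ψ) (hψc : HasCompactSupport ψ)
    (hψs : tsupport ψ ⊆ halfSpace n) :
    (1 + γ) ^ 2 / 4 * hardyTerm n γ ψ ≤ gradNormSq n c γ ψ := by
  obtain ⟨hFi, hF0⟩ := setIntegral_fderiv_rpow_mul_sq γ hψ hψc hψs
  have hB := (integrable_hardyTerm γ hψ.continuous hψc hψs).integrableOn (s := halfSpace n)
  have hA := (integrable_gradNormSq c γ hψ hψc hψs).integrableOn (s := halfSpace n)
  have h := setIntegral_mono_on ((hB.const_mul ((1 + γ) ^ 2 / 4)).add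
    (hFi.const_mul ((1 + γ) / 2))) hA (measurableSet_halfSpace n) fun x hx => by
      have hx0 : 0 < x.2 := hx
      have hE : 0 < x.2 ^ (-γ) := Real.rpow_pos_of_pos hx0 _
      simp only [Pi.add_apply]
      rw [fderiv_rpow_mul_sq γ (hψ.differentiable one_ne_zero) hx, rpow_neg_sub_two γ hx0,
        ← sub_nonneg]
      have key : 0 ≤ x.2 ^ (-γ) * (c ^ 2 * ∑ i : Fin n, (fderiv ℝ ψ x (Pi.single i 1, 0)) ^ 2
          + (fderiv ℝ ψ x (0, 1) - (1 + γ) / 2 * (ψ x / x.2)) ^ 2) := by positivity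
      refine key.trans_eq ?_
      field_simp
      ring
  rw [integral_add' (hB.const_mul _) (hFi.const_mul _), integral_const_mul, integral_const_mul,
    hF0, mul_zero, add_zero] at h
  exact h

/-- The exact relation between `‖∇_c (y^{-γ/2} ψ)‖_0²` and `‖∇_c ψ‖_γ²`. -/
theorem gradNormSq_rpow_mul (c γ : ℝ) (hψ : ContDiff ℝ 1 ψ) (hψc : HasCompactSupport ψ)
    (hψs : tsupport ψ ⊆ halfSpace n) :
    gradNormSq n c 0 (fun y => y.2 ^ (-(γ / 2)) * ψ y)
      = gradNormSq n c γ ψ - ((1 + γ) ^ 2 - 1) / 4 * hardyTerm n γ ψ := by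
  obtain ⟨hFi, hF0⟩ := setIntegral_fderiv_rpow_mul_sq γ hψ hψc hψs
  have hB := (integrable_hardyTerm γ hψ.continuous hψc hψs).integrableOn (s := halfSpace n)
  have hA := (integrable_gradNormSq c γ hψ hψc hψs).integrableOn (s := halfSpace n)
  have h := setIntegral_congr_fun (μ := volume) (measurableSet_halfSpace n)
    (f := fun x => (c ^ 2 * ∑ i : Fin n,
          (fderiv ℝ (fun y => y.2 ^ (-(γ / 2)) * ψ y) x (Pi.single i 1, 0)) ^ 2
        + (fderiv ℝ (fun y => y.2 ^ (-(γ / 2)) * ψ y) x (0, 1)) ^ 2) * x.2 ^ (-(0 : ℝ)))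
    (g := ((fun x => (c ^ 2 * ∑ i : Fin n, (fderiv ℝ ψ x (Pi.single i 1, 0)) ^ 2
        + (fderiv ℝ ψ x (0, 1)) ^ 2) * x.2 ^ (-γ)) -
        fun x => ((1 + γ) ^ 2 - 1) / 4 * (x.2 ^ (-γ - 2) * ψ x ^ 2)) -
        fun x => γ / 2 *
          fderiv ℝ (fun x : (Fin n → ℝ) × ℝ => x.2 ^ (-γ - 1) * (ψ x * ψ x)) x (0, 1))
    fun x hx => by
      have hx0 : 0 < x.2 := hx
      have hE : x.2 ^ (-γ) = (x.2 ^ (-(γ / 2))) ^ 2 := by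
        rw [sq, ← Real.rpow_add hx0]
        ring_nf
      have hd : Differentiable ℝ ψ := hψ.differentiable one_ne_zero
      simp only [Pi.sub_apply]
      rw [fderiv_rpow_mul_sq γ hd hx, rpow_neg_sub_two γ hx0, hE]
      simp only [fderiv_rpow_mul _ (hd x) hx, mul_pow, neg_zero, Real.rpow_zero, mul_zero,
        zero_mul, zero_div, add_zero, ← Finset.mul_sum]
      field_simp
      ring
  rw [integral_sub' (hA.sub (hB.const_mul _)) (hFi.const_mul _),
    integral_sub' hA (hB.const_mul _), integral_const_mul, integral_const_mul,
    hF0, mul_zero, sub_zero] at h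
  exact h

end CompactlySupported

/-- Lemma 3.3: equivalence of the weighted gradient norms `‖∇_c ψ‖_γ` and
`‖∇_c (y^{-γ/2} ψ)‖_0`, with constants `C̃_γ = min{1, 1/|1+γ|}` and
`C_γ = 1 + |γ/(1+γ)|`. -/
theorem lemma_3_3 (n : ℕ) (hn : 1 ≤ n) (γ : ℝ) (hγ : γ ≠ -1) (c : ℝ) (hc : 0 ≤ c)
    (ψ : (Fin n → ℝ) × ℝ → ℝ) (hψ : ContDiff ℝ (⊤ : ℕ∞) ψ) (hψc : HasCompactSupport ψ)
    (hψs : tsupport ψ ⊆ halfSpace n) :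
    min 1 (1 / |1 + γ|) * Real.sqrt (gradNormSq n c γ ψ)
      ≤ Real.sqrt (gradNormSq n c 0 (fun y => y.2 ^ (-(γ / 2)) * ψ y)) ∧
    Real.sqrt (gradNormSq n c 0 (fun y => y.2 ^ (-(γ / 2)) * ψ y))
      ≤ (1 + |γ / (1 + γ)|) * Real.sqrt (gradNormSq n c γ ψ) := by
  have hψ1 : ContDiff ℝ 1 ψ := hψ.of_le (by exact_mod_cast le_top)
  have hH := hardy_inequality c γ hψ1 hψc hψs
  rw [gradNormSq_rpow_mul c γ hψ1 hψc hψs]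
  have hB := hardyTerm_nonneg n γ ψ
  have hA := gradNormSq_nonneg n c γ ψ
  set A := gradNormSq n c γ ψ
  set B := hardyTerm n γ ψ
  have hpos : 0 < |1 + γ| := abs_pos.mpr fun h => hγ (by linarith)
  have hC : 1 / |1 + γ| ≤ 1 + |γ / (1 + γ)| := by
    rw [abs_div, div_le_iff₀ hpos, add_mul, div_mul_cancel₀ _ hpos.ne']
    have := abs_sub (1 + γ) γ
    simp only [add_sub_cancel_right, abs_one] at this
    linarith
  have hC1 : 1 ≤ 1 + |γ / (1 + γ)| := le_add_of_nonneg_right (abs_nonneg _)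
  generalize 1 + |γ / (1 + γ)| = C at hC hC1 ⊢
  rw [← sq_abs] at hH ⊢
  generalize |1 + γ| = s at hpos hC hH ⊢
  have hA' : (1 / s) ^ 2 * A - (A - (s ^ 2 - 1) / 4 * B)
      = (1 - s ^ 2) * ((1 / s) ^ 2 * (A - s ^ 2 / 4 * B)) := by
    field_simp
    ring
  have hm0 : 0 ≤ min 1 (1 / s) := by positivity
  have hgap : 0 ≤ (1 / s) ^ 2 * (A - s ^ 2 / 4 * B) := by
    have := sub_nonneg.mpr hH
    positivity
  constructor
  · apply Real.le_sqrt_of_sq_le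
    rw [mul_pow, Real.sq_sqrt hA]
    rcases le_total 1 s with hs | hs
    · have hs2 : 1 ≤ s ^ 2 := one_le_pow₀ hs
      calc min 1 (1 / s) ^ 2 * A ≤ (1 / s) ^ 2 * A := by gcongr; exact min_le_right _ _
        _ ≤ _ := sub_nonpos.mp (hA'.trans_le (mul_nonpos_of_nonpos_of_nonneg (by linarith) hgap))
    · have hs2 : s ^ 2 ≤ 1 := pow_le_one₀ hpos.le hs
      calc min 1 (1 / s) ^ 2 * A ≤ 1 ^ 2 * A := by gcongr; exact min_le_left _ _
        _ ≤ _ := by linarith [mul_nonneg (sub_nonneg.mpr hs2) hB]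
  · rw [Real.sqrt_le_left (by positivity), mul_pow, Real.sq_sqrt hA]
    rcases le_total 1 s with hs | hs
    · have hs2 : 1 ≤ s ^ 2 := one_le_pow₀ hs
      calc _ ≤ 1 ^ 2 * A := by linarith [mul_nonneg (sub_nonneg.mpr hs2) hB]
        _ ≤ C ^ 2 * A := by gcongr
    · have hs2 : s ^ 2 ≤ 1 := pow_le_one₀ hpos.le hs
      calc _ ≤ (1 / s) ^ 2 * A :=
            sub_nonneg.mp (hA'.symm ▸ mul_nonneg (sub_nonneg.mpr hs2) hgap)
        _ ≤ C ^ 2 * A := by gcongr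
end
end

section
/- Let R > 0, β > −1, let 2 ≤ p < ∞ be real, and set δ := (1+β)/2 + 1/p. Then for every continuously differentiable f : [0,R] → ℝ with f(0) = 0: (∫_0^R |f(y)/y^δ|^p dy)^{1/p} ≤ 2^{2/p} · (1/(1+β))^{(p+2)/(2p)} · (∫_0^R f'(y)² y^{-β} dy)^{1/2}. (Inequality (3.17)) -/
open MeasureTheory

noncomputable section

theorem lintegral_Ioo_rpow {y r : ℝ} (hy : 0 ≤ y) (hr : -1 < r) :
    ∫⁻ s in Set.Ioo 0 y, ENNReal.ofReal (s ^ r) = ENNReal.ofReal (y ^ (r + 1) / (r + 1)) := by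
  have hint : IntegrableOn (fun s : ℝ => s ^ r) (Set.Ioc 0 y) :=
    (intervalIntegrable_iff_integrableOn_Ioc_of_le hy).1
      (intervalIntegral.intervalIntegrable_rpow' hr)
  rw [restrict_Ioo_eq_restrict_Ioc, ← ofReal_integral_eq_lintegral_ofReal hint,
    ← intervalIntegral.integral_of_le hy, integral_rpow (Or.inl hr),
    Real.zero_rpow (by linarith), sub_zero]
  filter_upwards [ae_restrict_mem measurableSet_Ioc] with s hs
  exact Real.rpow_nonneg hs.1.le _

theorem lintegral_Ioi_rpow {s c : ℝ} (hs : 0 < s) (hc : 0 < c) :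
    ∫⁻ y in Set.Ioi s, ENNReal.ofReal (y ^ (-c - 1)) = ENNReal.ofReal (s ^ (-c) / c) := by
  rw [← ofReal_integral_eq_lintegral_ofReal (integrableOn_Ioi_rpow_of_lt (by linarith) hs),
    integral_Ioi_rpow_of_lt (by linarith) hs]
  · congr 1
    rw [show -c - 1 + 1 = -c by ring, neg_div_neg_eq]
  · filter_upwards [ae_restrict_mem measurableSet_Ioi] with y hy
    exact Real.rpow_nonneg (hs.trans hy).le _

/-- Weighted Cauchy-Schwarz estimate for a function vanishing at the origin. -/
theorem ofReal_sq_le_lintegral_deriv_sq_mul_rpow {y β γ : ℝ} (hy : 0 < y) (hγ : γ < 1 + β)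
    {f f' : ℝ → ℝ} (hderiv : ∀ s ∈ Set.Icc 0 y, HasDerivAt f (f' s) s)
    (hcont : ContinuousOn f' (Set.Icc 0 y)) (hf0 : f 0 = 0) :
    ENNReal.ofReal (f y ^ 2) ≤
      (∫⁻ s in Set.Ioo 0 y, ENNReal.ofReal (f' s ^ 2 * s ^ (-β)) * ENNReal.ofReal (s ^ γ)) *
        ENNReal.ofReal (y ^ (1 + β - γ) / (1 + β - γ)) := by
  have hftc : ∫ s in Set.Ioo 0 y, f' s = f y := by
    rw [← integral_Ioc_eq_integral_Ioo, ← intervalIntegral.integral_of_le hy.le,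
      intervalIntegral.integral_eq_sub_of_hasDerivAt (f := f), hf0, sub_zero]
    · rwa [Set.uIcc_of_le hy.le]
    · exact ContinuousOn.intervalIntegrable (by rwa [Set.uIcc_of_le hy.le])
  have hmeas : AEMeasurable f' (volume.restrict (Set.Ioo 0 y)) :=
    (hcont.mono Set.Ioo_subset_Icc_self).aemeasurable measurableSet_Ioo
  have hle : ‖f y‖ₑ ≤ ∫⁻ s in Set.Ioo 0 y, ‖f' s‖ₑ := by
    rw [← hftc]; exact enorm_integral_le_lintegral_enorm _
  have hsplit : ∫⁻ s in Set.Ioo 0 y, ‖f' s‖ₑ = ∫⁻ s in Set.Ioo 0 y,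
      ((fun s => ENNReal.ofReal (|f' s| * s ^ ((γ - β) / 2))) *
        fun s => ENNReal.ofReal (s ^ ((β - γ) / 2))) s := by
    refine setLIntegral_congr_fun measurableSet_Ioo fun s hs => ?_
    have hs0 := hs.1
    simp only [Pi.mul_apply]
    rw [← ENNReal.ofReal_mul (by positivity), mul_assoc, ← Real.rpow_add hs0,
      show (γ - β) / 2 + (β - γ) / 2 = 0 by ring, Real.rpow_zero, mul_one, ← Real.norm_eq_abs,
      ofReal_norm]
  have hholder := ENNReal.lintegral_mul_le_Lp_mul_Lq (volume.restrict (Set.Ioo 0 y))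
    Real.HolderConjugate.two_two
    (f := fun s => ENNReal.ofReal (|f' s| * s ^ ((γ - β) / 2)))
    (g := fun s => ENNReal.ofReal (s ^ ((β - γ) / 2)))
    (by
      have : AEMeasurable (fun s => |f' s|) (volume.restrict (Set.Ioo 0 y)) := hmeas.abs
      fun_prop) (by fun_prop)
  have hfst : ∫⁻ s in Set.Ioo 0 y, ENNReal.ofReal (|f' s| * s ^ ((γ - β) / 2)) ^ (2 : ℝ) =
      ∫⁻ s in Set.Ioo 0 y, ENNReal.ofReal (f' s ^ 2 * s ^ (-β)) * ENNReal.ofReal (s ^ γ) := by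
    refine setLIntegral_congr_fun measurableSet_Ioo fun s hs => ?_
    have hs0 := hs.1
    rw [← ENNReal.ofReal_mul (by positivity), ENNReal.rpow_ofNat,
      ← ENNReal.ofReal_pow (by positivity), mul_pow, sq_abs, mul_assoc, ← Real.rpow_add hs0,
      ← Real.rpow_mul_natCast hs0.le]
    congr 3
    push_cast
    ring
  have hsnd : ∫⁻ s in Set.Ioo 0 y, ENNReal.ofReal (s ^ ((β - γ) / 2)) ^ (2 : ℝ) =
      ENNReal.ofReal (y ^ (1 + β - γ) / (1 + β - γ)) := by
    rw [show 1 + β - γ = (β - γ) + 1 by ring, ← lintegral_Ioo_rpow hy.le (by linarith)]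
    refine setLIntegral_congr_fun measurableSet_Ioo fun s hs => ?_
    have hs0 := hs.1
    rw [ENNReal.rpow_ofNat, ← ENNReal.ofReal_pow (by positivity), ← Real.rpow_mul_natCast hs0.le]
    congr 2
    push_cast
    ring
  rw [← hsplit, hfst, hsnd] at hholder
  have hsq := pow_le_pow_left₀ (zero_le) (hle.trans hholder) 2
  rw [mul_pow, ← ENNReal.rpow_mul_natCast, ← ENNReal.rpow_mul_natCast] at hsq
  norm_num at hsq
  rwa [← ofReal_norm, ← ENNReal.ofReal_pow (norm_nonneg _), Real.norm_eq_abs, sq_abs] at hsq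

/-- The integrated kernel bound behind Hardy's inequality. -/
theorem lintegral_lintegral_mul_rpow_le {R c : ℝ} (hc : 0 < c) {G : ℝ → ENNReal}
    (hG : AEMeasurable G (volume.restrict (Set.Ioo 0 R))) :
    ∫⁻ y in Set.Ioo 0 R, (∫⁻ s in Set.Ioo 0 y, G s * ENNReal.ofReal (s ^ c)) *
        ENNReal.ofReal (y ^ (-c - 1)) ≤
      ENNReal.ofReal (1 / c) * ∫⁻ s in Set.Ioo 0 R, G s := by
  set μ := volume.restrict (Set.Ioo 0 R)
  let F : ℝ → ℝ → ENNReal := fun y s => Set.indicator {q : ℝ × ℝ | q.2 < q.1}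
    (fun q => G q.2 * ENNReal.ofReal (q.2 ^ c) * ENNReal.ofReal (q.1 ^ (-c - 1))) (y, s)
  have hF : AEMeasurable (Function.uncurry F) (μ.prod μ) := by
    refine AEMeasurable.indicator ?_ (measurableSet_lt measurable_snd measurable_fst)
    have : AEMeasurable (fun q : ℝ × ℝ => G q.2) (μ.prod μ) := hG.comp_snd
    fun_prop
  calc _ = ∫⁻ y, ∫⁻ s, F y s ∂μ ∂μ := by
        refine setLIntegral_congr_fun measurableSet_Ioo fun y hy => ?_
        rw [← lintegral_mul_const' _ _ ENNReal.ofReal_ne_top, ← lintegral_indicator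
          measurableSet_Ioo, ← lintegral_indicator measurableSet_Ioo]
        refine lintegral_congr fun s => ?_
        simp only [Set.indicator_apply, F, Set.mem_Ioo, Set.mem_ofPred_eq]
        have := hy.2
        by_cases h1 : 0 < s <;> by_cases h2 : s < y <;> simp [h1, h2]
        intro h3; linarith
    _ = ∫⁻ s, ∫⁻ y, F y s ∂μ ∂μ := lintegral_lintegral_swap hF
    _ ≤ ∫⁻ s, ENNReal.ofReal (1 / c) * G s ∂μ := by
        refine setLIntegral_mono_ae' measurableSet_Ioo (Filter.Eventually.of_forall fun s hs => ?_)
        have hs0 := hs.1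
        calc ∫⁻ y, F y s ∂μ ≤ ∫⁻ y, F y s := setLIntegral_le_lintegral _ _
          _ = ∫⁻ y in Set.Ioi s, G s * ENNReal.ofReal (s ^ c) * ENNReal.ofReal (y ^ (-c - 1)) := by
              rw [← lintegral_indicator measurableSet_Ioi]
              rfl
          _ = G s * ENNReal.ofReal (s ^ c) * ENNReal.ofReal (s ^ (-c) / c) := by
              rw [lintegral_const_mul _ (by fun_prop), lintegral_Ioi_rpow hs0 hc]
          _ = ENNReal.ofReal (1 / c) * G s := by
              rw [mul_assoc, ← ENNReal.ofReal_mul (by positivity), mul_comm, ← mul_div_assoc,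
                ← Real.rpow_add hs0, add_neg_cancel, Real.rpow_zero]
    _ = _ := lintegral_const_mul' _ _ ENNReal.ofReal_ne_top

/-- Hardy's inequality with power weights. -/
theorem lintegral_sq_mul_rpow_le {R β : ℝ} (hβ : -1 < β)
    {f f' : ℝ → ℝ} (hderiv : ∀ y ∈ Set.Icc 0 R, HasDerivAt f (f' y) y)
    (hcont : ContinuousOn f' (Set.Icc 0 R)) (hf0 : f 0 = 0) :
    ∫⁻ y in Set.Ioo 0 R, ENNReal.ofReal (f y ^ 2 * y ^ (-(1 + β) - 1)) ≤
      ENNReal.ofReal (4 / (1 + β) ^ 2) *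
        ∫⁻ y in Set.Ioo 0 R, ENNReal.ofReal (f' y ^ 2 * y ^ (-β)) := by
  have ha : 0 < 1 + β := by linarith
  have hmeas : AEMeasurable f' (volume.restrict (Set.Ioo 0 R)) :=
    (hcont.mono Set.Ioo_subset_Icc_self).aemeasurable measurableSet_Ioo
  set c := (1 + β) / 2 with hcdef
  have hc : 0 < c := by positivity
  set G : ℝ → ENNReal := fun s => ENNReal.ofReal (f' s ^ 2 * s ^ (-β))
  calc _ ≤ ∫⁻ y in Set.Ioo 0 R, ENNReal.ofReal (1 / c) *
        ((∫⁻ s in Set.Ioo 0 y, G s * ENNReal.ofReal (s ^ c)) * ENNReal.ofReal (y ^ (-c - 1))) := by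
        refine setLIntegral_mono_ae' measurableSet_Ioo (Filter.Eventually.of_forall fun y hy => ?_)
        have hy0 := hy.1
        have hsub : Set.Icc 0 y ⊆ Set.Icc 0 R := Set.Icc_subset_Icc_right hy.2.le
        have h := ofReal_sq_le_lintegral_deriv_sq_mul_rpow hy0 (show c < 1 + β by linarith)
          (fun s hs => hderiv s (hsub hs)) (hcont.mono hsub) hf0
        rw [ENNReal.ofReal_mul (sq_nonneg _)]
        refine (mul_le_mul_left h _).trans (le_of_eq ?_)
        rw [mul_assoc, ← ENNReal.ofReal_mul (by rw [show 1 + β - c = c by ring]; positivity),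
          mul_left_comm, ← ENNReal.ofReal_mul (by positivity)]
        congr 2
        rw [show 1 + β - c = c by ring, div_mul_eq_mul_div, ← Real.rpow_add hy0,
          one_div_mul_eq_div]
        congr 2
        ring
    _ ≤ ENNReal.ofReal (1 / c) * (ENNReal.ofReal (1 / c) * ∫⁻ s in Set.Ioo 0 R, G s) := by
        rw [lintegral_const_mul' _ _ ENNReal.ofReal_ne_top]
        gcongr
        exact lintegral_lintegral_mul_rpow_le hc (by fun_prop)
    _ = _ := by
        rw [← mul_assoc, ← ENNReal.ofReal_mul (by positivity)]
        congr 2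
        rw [hcdef]
        field_simp
        norm_num

theorem abs_div_rpow_rpow_eq {x y a p : ℝ} (hy : 0 < y) (hp : 2 ≤ p) :
    |x / y ^ (a / 2 + 1 / p)| ^ p =
      x ^ 2 * y ^ (-a - 1) * (x ^ 2 * y ^ (-a)) ^ ((p - 2) / 2) := by
  have hx : |x| ^ p = x ^ 2 * (x ^ 2) ^ ((p - 2) / 2) := by
    rw [← sq_abs, ← Real.rpow_natCast_mul (abs_nonneg x), ← Real.rpow_natCast,
      ← Real.rpow_add_of_nonneg (abs_nonneg x) (by norm_num) (by push_cast; linarith)]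
    congr 1
    push_cast
    ring
  rw [abs_div, abs_of_pos (Real.rpow_pos_of_pos hy _),
    Real.div_rpow (abs_nonneg x) (by positivity), hx, Real.mul_rpow (sq_nonneg x) (by positivity),
    ← Real.rpow_mul hy.le, ← Real.rpow_mul hy.le, div_eq_mul_inv, ← Real.rpow_neg hy.le,
    mul_mul_mul_comm, ← Real.rpow_add hy]
  congr 2
  field_simp
  ring

theorem interpolation_constant_eq {a j p : ℝ} (ha : 0 < a) (hj : 0 ≤ j) (hp : 2 ≤ p) :
    ((1 / a * j) ^ ((p - 2) / 2) * (4 / a ^ 2 * j)) ^ (1 / p) =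
      2 ^ (2 / p) * (1 / a) ^ ((p + 2) / (2 * p)) * j ^ ((1 : ℝ) / 2) := by
  have hb : 0 < 1 / a := by positivity
  have hbase : (1 / a * j) ^ ((p - 2) / 2) * (4 / a ^ 2 * j) =
      2 ^ (2 : ℝ) * (1 / a) ^ ((p + 2) / 2) * j ^ (p / 2) := by
    rw [show (p + 2) / 2 = (p - 2) / 2 + 2 by ring, show p / 2 = (p - 2) / 2 + 1 by ring,
      Real.rpow_add hb, Real.rpow_add_of_nonneg hj (by linarith) zero_le_one, Real.rpow_one,
      Real.mul_rpow hb.le hj, Real.rpow_two, Real.rpow_two]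
    ring
  rw [hbase, Real.mul_rpow (by positivity) (by positivity),
    Real.mul_rpow (by positivity) (by positivity), ← Real.rpow_mul (by norm_num),
    ← Real.rpow_mul hb.le, ← Real.rpow_mul hj, mul_one_div, mul_one_div, mul_one_div, div_div,
    div_right_comm, div_self (by positivity)]

/-- Inequality (3.17): the interpolated one-dimensional weighted estimate
`(∫₀^R |f/y^δ|^p dy)^{1/p} ≤ 2^{2/p} (1/(1+β))^{(p+2)/(2p)} (∫₀^R f'² y^{-β} dy)^{1/2}`,
with `δ = (1+β)/2 + 1/p`, for `f ∈ C¹([0,R])` with `f(0) = 0`. Both sides are formalized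
with lower Lebesgue integrals, which may take the value `+∞`. -/
theorem ineq_3_17 (R β p : ℝ) (hR : 0 < R) (hβ : -1 < β) (hp2 : 2 ≤ p)
    (f f' : ℝ → ℝ) (hderiv : ∀ y ∈ Set.Icc 0 R, HasDerivAt f (f' y) y)
    (hcont : ContinuousOn f' (Set.Icc 0 R)) (hf0 : f 0 = 0) :
    (∫⁻ y in Set.Ioo 0 R,
        ENNReal.ofReal (|f y / y ^ ((1 + β) / 2 + 1 / p)| ^ p)) ^ (1 / p)
      ≤ ENNReal.ofReal (2 ^ (2 / p) * (1 / (1 + β)) ^ ((p + 2) / (2 * p))) *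
        (∫⁻ y in Set.Ioo 0 R, ENNReal.ofReal ((f' y) ^ 2 * y ^ (-β))) ^ ((1 : ℝ) / 2) := by
  have ha : 0 < 1 + β := by linarith
  have hardy := lintegral_sq_mul_rpow_le hβ hderiv hcont hf0
  have hpoint : ∀ y ∈ Set.Ioo 0 R, ENNReal.ofReal (f y ^ 2) ≤
      (∫⁻ y in Set.Ioo 0 R, ENNReal.ofReal ((f' y) ^ 2 * y ^ (-β))) *
        ENNReal.ofReal (y ^ (1 + β) / (1 + β)) := by
    intro y hy
    have hsub : Set.Icc 0 y ⊆ Set.Icc 0 R := Set.Icc_subset_Icc_right hy.2.le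
    have h := ofReal_sq_le_lintegral_deriv_sq_mul_rpow hy.1 ha
      (fun s hs => hderiv s (hsub hs)) (hcont.mono hsub) hf0
    simp only [Real.rpow_zero, ENNReal.ofReal_one, mul_one, sub_zero] at h
    exact h.trans (mul_le_mul_left (lintegral_mono_set (Set.Ioo_subset_Ioo_right hy.2.le)) _)
  generalize (∫⁻ y in Set.Ioo 0 R, ENNReal.ofReal ((f' y) ^ 2 * y ^ (-β))) = J at hardy hpoint ⊢
  rcases eq_or_ne J ⊤ with rfl | hJ
  · rw [ENNReal.top_rpow_of_pos (by norm_num), ENNReal.mul_top]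
    · exact le_top
    · rw [Ne, ENNReal.ofReal_eq_zero, not_le]
      positivity
  lift J to NNReal using hJ
  set j : ℝ := (J : ℝ)
  have hJj : (J : ENNReal) = ENNReal.ofReal j := ENNReal.ofReal_coe_nnreal.symm
  have hj : 0 ≤ j := J.2
  rw [hJj] at hardy hpoint ⊢
  have hbound : ∫⁻ y in Set.Ioo 0 R, ENNReal.ofReal (|f y / y ^ ((1 + β) / 2 + 1 / p)| ^ p) ≤
      ENNReal.ofReal ((1 / (1 + β) * j) ^ ((p - 2) / 2) * (4 / (1 + β) ^ 2 * j)) := by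
    calc _ ≤ ∫⁻ y in Set.Ioo 0 R, ENNReal.ofReal ((1 / (1 + β) * j) ^ ((p - 2) / 2)) *
          ENNReal.ofReal (f y ^ 2 * y ^ (-(1 + β) - 1)) := by
          refine setLIntegral_mono_ae' measurableSet_Ioo
            (Filter.Eventually.of_forall fun y hy => ?_)
          have hy0 := hy.1
          have h := hpoint y hy
          rw [← ENNReal.ofReal_mul hj, ENNReal.ofReal_le_ofReal_iff (by positivity)] at h
          have hle : f y ^ 2 * y ^ (-(1 + β)) ≤ 1 / (1 + β) * j := by
            rw [Real.rpow_neg hy0.le, ← div_eq_mul_inv, div_le_iff₀ (by positivity)]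
            exact h.trans (le_of_eq (by ring))
          rw [abs_div_rpow_rpow_eq hy0 hp2, ← ENNReal.ofReal_mul (by positivity), mul_comm]
          exact ENNReal.ofReal_le_ofReal (mul_le_mul_of_nonneg_right
            (Real.rpow_le_rpow (by positivity) hle (by linarith)) (by positivity))
      _ ≤ _ := by
          rw [lintegral_const_mul' _ _ ENNReal.ofReal_ne_top, ENNReal.ofReal_mul (by positivity),
            ENNReal.ofReal_mul (p := 4 / (1 + β) ^ 2) (by positivity)]
          gcongr
  calc _ ≤ ENNReal.ofReal ((1 / (1 + β) * j) ^ ((p - 2) / 2) * (4 / (1 + β) ^ 2 * j)) ^ (1 / p) :=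
        ENNReal.rpow_le_rpow hbound (by positivity)
    _ = _ := by
        rw [ENNReal.ofReal_rpow_of_nonneg (by positivity) (by positivity),
          ENNReal.ofReal_rpow_of_nonneg hj (by norm_num), ← ENNReal.ofReal_mul (by positivity),
          interpolation_constant_eq ha hj hp2]
end
end

section
/- Let c > 0, R > 0, β > −1, let 2 ≤ p ≤ 4 be real, and set δ := β/2 + (6−p)/(2p). Then for every smooth ψ : ℝ² → ℝ with compact support contained in the half-disc B_R⁺ := {(x,y) ∈ ℝ² : x²+y² < R², y > 0}: (∫ |ψ(x,y)/y^δ|^p dx dy)^{1/p} ≤ (2/(1+β))^{(6−p)/(2p)} · (R/c²)^{(p−2)/(2p)} · (∫ (c²(∂_x ψ)² + (∂_y ψ)²) y^{-β} dx dy)^{1/2}, the integrals being over B_R⁺. (Proposition 3.4, small-p case) -/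
open MeasureTheory

noncomputable section

/-- The open upper half-disc `B_R⁺ = {(x,y) : x² + y² < R², y > 0}`. -/
def halfDisc (R : ℝ) : Set (ℝ × ℝ) := {x | x.1 ^ 2 + x.2 ^ 2 < R ^ 2 ∧ 0 < x.2}

open Set Filter Topology

section Weight

variable {K : Set (ℝ × ℝ)} {f : ℝ × ℝ → ℝ}

lemma contDiff_mul_snd_rpow_s10 (hK : IsClosed K) (hK0 : ∀ x ∈ K, 0 < x.2) (hf0 : ∀ x ∉ K, f x = 0)
    (hf : ContDiff ℝ 1 f) (r : ℝ) : ContDiff ℝ 1 fun x ↦ f x * x.2 ^ r := by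
  rw [contDiff_iff_contDiffAt]
  intro x
  by_cases hx : x ∈ K
  · exact hf.contDiffAt.mul (contDiffAt_snd.rpow_const_of_ne (hK0 x hx).ne')
  · refine (contDiffAt_const (c := (0 : ℝ))).congr_of_eventuallyEq ?_
    filter_upwards [hK.isOpen_compl.mem_nhds hx] with z hz
    simp [hf0 z hz]

lemma continuous_mul_snd_rpow (hK : IsClosed K) (hK0 : ∀ x ∈ K, 0 < x.2) (hf0 : ∀ x ∉ K, f x = 0)
    (hf : Continuous f) (r : ℝ) : Continuous fun x ↦ f x * x.2 ^ r := by
  rw [continuous_iff_continuousAt]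
  intro x
  by_cases hx : x ∈ K
  · exact hf.continuousAt.mul (continuousAt_snd.rpow_const (Or.inl (hK0 x hx).ne'))
  · refine (continuousAt_const (y := (0 : ℝ))).congr ?_
    filter_upwards [hK.isOpen_compl.mem_nhds hx] with z hz
    simp [hf0 z hz]

lemma hasCompactSupport_mul_snd_rpow (hK : IsCompact K) (hf0 : ∀ x ∉ K, f x = 0) (r : ℝ) :
    HasCompactSupport fun x ↦ f x * x.2 ^ r :=
  HasCompactSupport.intro hK fun x hx ↦ by simp [hf0 x hx]

lemma integrable_mul_snd_rpow (hK : IsCompact K) (hK0 : ∀ x ∈ K, 0 < x.2)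
    (hf0 : ∀ x ∉ K, f x = 0) (hf : Continuous f) (r : ℝ) :
    Integrable fun x ↦ f x * x.2 ^ r :=
  (continuous_mul_snd_rpow hK.isClosed hK0 hf0 hf r).integrable_of_hasCompactSupport
    (hasCompactSupport_mul_snd_rpow hK hf0 r)

lemma fderiv_mul_snd_rpow (hK : IsClosed K) (hK0 : ∀ x ∈ K, 0 < x.2) (hf0 : ∀ x ∉ K, f x = 0)
    (hf : ContDiff ℝ 1 f) (r : ℝ) (x v : ℝ × ℝ) :
    fderiv ℝ (fun x ↦ f x * x.2 ^ r) x v =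
      fderiv ℝ f x v * x.2 ^ r + f x * (r * x.2 ^ (r - 1) * v.2) := by
  by_cases hx : x ∈ K
  · have h1 := (hf.differentiable one_ne_zero x).hasFDerivAt
    have h2 := (hasFDerivAt_snd (𝕜 := ℝ) (p := x)).rpow_const (p := r) (Or.inl (hK0 x hx).ne')
    have h3 : HasFDerivAt (fun x ↦ f x * x.2 ^ r) _ x := h1.mul h2
    rw [h3.fderiv]
    simp
    ring
  · have h1 : f =ᶠ[𝓝 x] fun _ ↦ (0 : ℝ) := by
      filter_upwards [hK.isOpen_compl.mem_nhds hx] with z hz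
      exact hf0 z hz
    have h2 : (fun x ↦ f x * x.2 ^ r) =ᶠ[𝓝 x] fun _ ↦ (0 : ℝ) := by
      filter_upwards [h1] with z hz
      simp [hz]
    rw [h1.fderiv_eq, h2.fderiv_eq, hf0 x hx]
    simp

lemma integral_fderiv_apply_eq_zero (hf : ContDiff ℝ 1 f) (hc : HasCompactSupport f)
    (v : ℝ × ℝ) : ∫ x, fderiv ℝ f x v = 0 := by
  have hd : Continuous fun x ↦ fderiv ℝ f x v :=
    (hf.continuous_fderiv one_ne_zero).clm_apply continuous_const
  have hdc : HasCompactSupport fun x ↦ fderiv ℝ f x v := hc.fderiv_apply ℝ v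
  have h := integral_mul_fderiv_eq_neg_fderiv_mul_of_integrable (μ := (volume : Measure (ℝ × ℝ)))
    (f := fun _ ↦ (1 : ℝ)) (g := f) (v := v) (by simp)
    (by simpa using hd.integrable_of_hasCompactSupport hdc)
    (by simpa using hf.continuous.integrable_of_hasCompactSupport hc)
    (by intro x _; exact differentiableAt_const _)
    (by intro x _; exact hf.differentiable one_ne_zero x)
  simpa using h

end Weight

section Line

variable {g h : ℝ → ℝ}

lemma abs_le_half_integral_abs_deriv (hg : ContDiff ℝ 1 g) (hc : HasCompactSupport g) (x : ℝ) :
    |g x| ≤ (∫ t, |deriv g t|) / 2 := by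
  have hi : Integrable (deriv g) :=
    (hg.continuous_deriv le_rfl).integrable_of_hasCompactSupport hc.deriv
  have h1 : |g x| ≤ ∫ t in Iic x, |deriv g t| := by
    rw [← hc.integral_Iic_deriv_eq hg x]
    exact abs_integral_le_integral_abs
  have h2 : |g x| ≤ ∫ t in Ioi x, |deriv g t| := by
    rw [← abs_neg, ← hc.integral_Ioi_deriv_eq hg x]
    exact abs_integral_le_integral_abs
  have h3 := intervalIntegral.integral_Iic_add_Ioi (b := x) hi.abs.integrableOn hi.abs.integrableOn
  linarith

lemma le_integral_of_deriv_le (hg : ContDiff ℝ 1 g) (hc : HasCompactSupport g)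
    (hh : Integrable h) (hh0 : ∀ t, 0 ≤ h t) (hle : ∀ t, deriv g t ≤ h t) (x : ℝ) :
    g x ≤ ∫ t, h t := by
  have hi : Integrable (deriv g) :=
    (hg.continuous_deriv le_rfl).integrable_of_hasCompactSupport hc.deriv
  rw [← hc.integral_Iic_deriv_eq hg x]
  exact (setIntegral_mono hi.integrableOn hh.integrableOn hle).trans
    (setIntegral_le_integral hh (Eventually.of_forall hh0))

lemma le_integral_of_neg_deriv_le (hg : ContDiff ℝ 1 g) (hc : HasCompactSupport g)
    (hh : Integrable h) (hh0 : ∀ t, 0 ≤ h t) (hle : ∀ t, -deriv g t ≤ h t) (x : ℝ) :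
    g x ≤ ∫ t, h t := by
  have hi : Integrable (deriv g) :=
    (hg.continuous_deriv le_rfl).integrable_of_hasCompactSupport hc.deriv
  rw [← neg_neg (g x), ← hc.integral_Ioi_deriv_eq hg x, ← integral_neg]
  exact (setIntegral_mono hi.neg.integrableOn hh.integrableOn hle).trans
    (setIntegral_le_integral hh (Eventually.of_forall hh0))

end Line

/-- Interpolation of integral bounds. -/
lemma integral_le_rpow_mul_rpow {α : Type*} [MeasurableSpace α] {μ : Measure α} {X Y Z : α → ℝ}
    (hX : Integrable X μ) (hY : Integrable Y μ) (hX0 : ∀ x, 0 ≤ X x) (hY0 : ∀ x, 0 ≤ Y x)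
    {A B t : ℝ} (hZ0 : ∀ x, 0 ≤ Z x) (hZ : ∀ x, Z x ≤ X x ^ (1 - t) * Y x ^ t)
    (hA : 0 < A) (hB : 0 < B) (ht0 : 0 ≤ t) (ht1 : t ≤ 1)
    (hXA : ∫ x, X x ∂μ ≤ A) (hYB : ∫ x, Y x ∂μ ≤ B) :
    ∫ x, Z x ∂μ ≤ A ^ (1 - t) * B ^ t := by
  have hAB : 0 < A ^ (1 - t) * B ^ t := by positivity
  have hpt : ∀ x, X x ^ (1 - t) * Y x ^ t ≤
      A ^ (1 - t) * B ^ t * ((1 - t) / A * X x + t / B * Y x) := by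
    intro x
    have h := Real.geom_mean_le_arith_mean2_weighted (sub_nonneg.2 ht1) ht0
      (div_nonneg (hX0 x) hA.le) (div_nonneg (hY0 x) hB.le) (by ring)
    rw [Real.div_rpow (hX0 x) hA.le, Real.div_rpow (hY0 x) hB.le, div_mul_div_comm,
      div_le_iff₀' hAB] at h
    refine h.trans_eq ?_
    ring
  calc ∫ x, Z x ∂μ
      ≤ ∫ x, A ^ (1 - t) * B ^ t * ((1 - t) / A * X x + t / B * Y x) ∂μ := by
        exact integral_mono_of_nonneg (Eventually.of_forall hZ0)
          (((hX.const_mul _).add (hY.const_mul _)).const_mul _)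
          (Eventually.of_forall fun x ↦ (hZ x).trans (hpt x))
    _ = A ^ (1 - t) * B ^ t * ((1 - t) / A * ∫ x, X x ∂μ + t / B * ∫ x, Y x ∂μ) := by
        rw [integral_const_mul, integral_add (hX.const_mul _) (hY.const_mul _),
          integral_const_mul, integral_const_mul]
    _ ≤ A ^ (1 - t) * B ^ t * ((1 - t) / A * A + t / B * B) := by
        have := sub_nonneg.2 ht1
        gcongr
    _ = A ^ (1 - t) * B ^ t := by field_simp; ring

section Energy

variable {K : Set (ℝ × ℝ)} {u : ℝ × ℝ → ℝ}

lemma fderiv_sq_apply (hu : ContDiff ℝ 1 u) (x v : ℝ × ℝ) :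
    fderiv ℝ (fun x ↦ u x ^ 2) x v = 2 * u x * fderiv ℝ u x v := by
  have h := (hu.differentiable one_ne_zero x).hasFDerivAt.pow 2
  have h' : HasFDerivAt (fun x ↦ u x ^ 2) _ x := h
  rw [h'.fderiv]
  simp

lemma continuous_fderiv_apply_const (hu : ContDiff ℝ 1 u) (v : ℝ × ℝ) :
    Continuous fun x ↦ fderiv ℝ u x v :=
  (hu.continuous_fderiv one_ne_zero).clm_apply continuous_const

lemma rpow_sub_add_identities {y : ℝ} (hy : 0 < y) (β : ℝ) :
    y ^ (-β - 1) = y ^ (-β - 2) * y ∧ y ^ (-β) = y ^ (-β - 2) * y ^ 2 := by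
  constructor
  · rw [← Real.rpow_add_one hy.ne']
    ring_nf
  · rw [← Real.rpow_natCast, ← Real.rpow_add hy]
    norm_num

/-- Weighted Hardy inequality in the vertical variable. -/
lemma integral_sq_mul_rpow_le_hardy (hK : IsCompact K) (hK0 : ∀ x ∈ K, 0 < x.2)
    (hu0 : ∀ x ∉ K, u x = 0) (hu0' : ∀ x ∉ K, fderiv ℝ u x = 0) (hu : ContDiff ℝ 1 u)
    {β : ℝ} (hβ : -1 < β) :
    ∫ x, u x ^ 2 * x.2 ^ (-β - 2) ≤
      (2 / (1 + β)) ^ 2 * ∫ x, fderiv ℝ u x (0, 1) ^ 2 * x.2 ^ (-β) := by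
  have hk : 0 < 1 + β := by linarith
  have hF0 : ∀ x ∉ K, u x ^ 2 = 0 := fun x hx ↦ by simp [hu0 x hx]
  have hF := contDiff_mul_snd_rpow_s10 hK.isClosed hK0 hF0 (hu.pow 2) (-β - 1)
  have hFc := hasCompactSupport_mul_snd_rpow hK hF0 (-β - 1)
  have hI := integrable_mul_snd_rpow hK hK0 hF0 (hu.pow 2).continuous (-β - 2)
  have hJ := integrable_mul_snd_rpow (f := fun x ↦ fderiv ℝ u x (0, 1) ^ 2) hK hK0
    (fun x hx ↦ by simp [hu0' x hx]) ((continuous_fderiv_apply_const hu _).pow 2) (-β)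
  have h0 := integral_fderiv_apply_eq_zero hF hFc (0, 1)
  have hmono := integral_mono
    (((continuous_fderiv_apply_const hF (0, 1)).integrable_of_hasCompactSupport
      (hFc.fderiv_apply ℝ _)))
    ((hJ.const_mul (2 / (1 + β))).sub (hI.const_mul ((1 + β) / 2))) (fun x ↦ by
      simp only [Pi.sub_apply]
      rw [fderiv_mul_snd_rpow hK.isClosed hK0 hF0 (hu.pow 2), fderiv_sq_apply hu]
      by_cases hx : x ∈ K
      · obtain ⟨e1, e2⟩ := rpow_sub_add_identities (hK0 x hx) β
        have hw : 0 ≤ x.2 ^ (-β - 2) := Real.rpow_nonneg (hK0 x hx).le _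
        rw [show -β - 1 - 1 = -β - 2 by ring, e1, e2]
        have key : 0 ≤ x.2 ^ (-β - 2) * (2 / (1 + β)) *
            (fderiv ℝ u x (0, 1) * x.2 - (1 + β) / 2 * u x) ^ 2 := by positivity
        have : x.2 ^ (-β - 2) * (2 / (1 + β)) *
            (fderiv ℝ u x (0, 1) * x.2 - (1 + β) / 2 * u x) ^ 2 =
            (2 / (1 + β) * (fderiv ℝ u x (0, 1) ^ 2 * (x.2 ^ (-β - 2) * x.2 ^ 2)) -
              (1 + β) / 2 * (u x ^ 2 * x.2 ^ (-β - 2))) -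
            (2 * u x * fderiv ℝ u x (0, 1) * (x.2 ^ (-β - 2) * x.2) +
              u x ^ 2 * ((-β - 1) * x.2 ^ (-β - 2) * 1)) := by
          field_simp
          ring
        linarith
      · simp [hu0 x hx, hu0' x hx])
  rw [h0] at hmono
  simp only [Pi.sub_apply] at hmono
  rw [integral_sub (hJ.const_mul _) (hI.const_mul _), integral_const_mul, integral_const_mul]
    at hmono
  set I := ∫ x, u x ^ 2 * x.2 ^ (-β - 2)
  set J := ∫ x, fderiv ℝ u x (0, 1) ^ 2 * x.2 ^ (-β)
  calc I = 2 / (1 + β) * ((1 + β) / 2 * I) := by field_simp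
    _ ≤ 2 / (1 + β) * (2 / (1 + β) * J) :=
        mul_le_mul_of_nonneg_left (by linarith) (by positivity)
    _ = (2 / (1 + β)) ^ 2 * J := by ring

/-- Weighted Poincaré inequality in the horizontal variable. -/
lemma integral_sq_mul_rpow_le_poincare (hK : IsCompact K) (hK0 : ∀ x ∈ K, 0 < x.2)
    {R : ℝ} (hKR : ∀ x ∈ K, x.1 ^ 2 ≤ R ^ 2)
    (hu0 : ∀ x ∉ K, u x = 0) (hu0' : ∀ x ∉ K, fderiv ℝ u x = 0) (hu : ContDiff ℝ 1 u) (r : ℝ) :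
    ∫ x, u x ^ 2 * x.2 ^ r ≤ 4 * R ^ 2 * ∫ x, fderiv ℝ u x (1, 0) ^ 2 * x.2 ^ r := by
  have hf : ContDiff ℝ 1 fun x : ℝ × ℝ ↦ x.1 * u x ^ 2 := contDiff_fst.mul (hu.pow 2)
  have hf0 : ∀ x ∉ K, x.1 * u x ^ 2 = 0 := fun x hx ↦ by simp [hu0 x hx]
  have hF := contDiff_mul_snd_rpow_s10 hK.isClosed hK0 hf0 hf r
  have hFc := hasCompactSupport_mul_snd_rpow hK hf0 r
  have hI := integrable_mul_snd_rpow hK hK0 (fun x hx ↦ by simp [hu0 x hx] : ∀ x ∉ K, u x ^ 2 = 0)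
    (hu.pow 2).continuous r
  have hJ := integrable_mul_snd_rpow (f := fun x ↦ fderiv ℝ u x (1, 0) ^ 2) hK hK0
    (fun x hx ↦ by simp [hu0' x hx]) ((continuous_fderiv_apply_const hu _).pow 2) r
  have hfd : ∀ x : ℝ × ℝ, fderiv ℝ (fun x : ℝ × ℝ ↦ x.1 * u x ^ 2) x (1, 0) =
      u x ^ 2 + x.1 * (2 * u x * fderiv ℝ u x (1, 0)) := by
    intro x
    have h : HasFDerivAt (fun x : ℝ × ℝ ↦ x.1 * u x ^ 2) _ x :=
      (hasFDerivAt_fst (𝕜 := ℝ) (p := x)).mul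
        (((hu.pow 2).differentiable one_ne_zero x).hasFDerivAt)
    rw [h.fderiv]
    simp [fderiv_sq_apply hu]
    ring
  have h0 := integral_fderiv_apply_eq_zero hF hFc (1, 0)
  have hmono := integral_mono
    ((hI.const_mul (1 / 2)).sub (hJ.const_mul (2 * R ^ 2)))
    (((continuous_fderiv_apply_const hF (1, 0)).integrable_of_hasCompactSupport
      (hFc.fderiv_apply ℝ _))) (fun x ↦ by
      simp only [Pi.sub_apply]
      rw [fderiv_mul_snd_rpow hK.isClosed hK0 hf0 hf, hfd]
      by_cases hx : x ∈ K
      · have hw : 0 ≤ x.2 ^ r := Real.rpow_nonneg (hK0 x hx).le _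
        have h1 : x.1 ^ 2 * fderiv ℝ u x (1, 0) ^ 2 ≤ R ^ 2 * fderiv ℝ u x (1, 0) ^ 2 :=
          mul_le_mul_of_nonneg_right (hKR x hx) (sq_nonneg _)
        have h2 : 0 ≤ x.2 ^ r * ((u x ^ 2 + x.1 * (2 * u x * fderiv ℝ u x (1, 0))) -
            (1 / 2 * u x ^ 2 - 2 * R ^ 2 * fderiv ℝ u x (1, 0) ^ 2)) := by
          apply mul_nonneg hw
          nlinarith [sq_nonneg (u x + 2 * (x.1 * fderiv ℝ u x (1, 0)))]
        linarith
      · simp [hu0 x hx, hu0' x hx])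
  rw [h0] at hmono
  simp only [Pi.sub_apply] at hmono
  rw [integral_sub (hI.const_mul _) (hJ.const_mul _), integral_const_mul, integral_const_mul]
    at hmono
  linarith

lemma sq_mul_rpow_le_integral_fst (hK : IsCompact K) (hK0 : ∀ x ∈ K, 0 < x.2)
    (hu0 : ∀ x ∉ K, u x = 0) (hu : ContDiff ℝ 1 u) (r : ℝ) (x : ℝ × ℝ) :
    u x ^ 2 * x.2 ^ r ≤ ∫ t, |u (t, x.2) * fderiv ℝ u (t, x.2) (1, 0)| * x.2 ^ r := by
  have hF0 : ∀ x ∉ K, u x ^ 2 = 0 := fun x hx ↦ by simp [hu0 x hx]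
  have hF := contDiff_mul_snd_rpow_s10 hK.isClosed hK0 hF0 (hu.pow 2) r
  have hg : ContDiff ℝ 1 fun t : ℝ ↦ u (t, x.2) ^ 2 * x.2 ^ r :=
    hF.comp (contDiff_id.prodMk contDiff_const)
  have hgc : HasCompactSupport fun t : ℝ ↦ u (t, x.2) ^ 2 * x.2 ^ r :=
    HasCompactSupport.intro (hK.image continuous_fst) fun t ht ↦ by
      rw [hu0 (t, x.2) fun h ↦ ht ⟨_, h, rfl⟩]
      simp
  have hd : ∀ t, deriv (fun t : ℝ ↦ u (t, x.2) ^ 2 * x.2 ^ r) t =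
      2 * u (t, x.2) * fderiv ℝ u (t, x.2) (1, 0) * x.2 ^ r := by
    intro t
    have h := (hF.differentiable one_ne_zero (t, x.2)).hasFDerivAt.comp_hasDerivAt t
      ((hasDerivAt_id t).prodMk (hasDerivAt_const t x.2))
    have h' : HasDerivAt (fun t : ℝ ↦ u (t, x.2) ^ 2 * x.2 ^ r) _ t := h
    rw [h'.deriv, fderiv_mul_snd_rpow hK.isClosed hK0 hF0 (hu.pow 2), fderiv_sq_apply hu]
    simp
  have h := abs_le_half_integral_abs_deriv hg hgc x.1
  refine (le_abs_self _).trans (h.trans_eq ?_)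
  rw [div_eq_inv_mul, ← integral_const_mul]
  congr 1 with t
  rw [hd]
  by_cases hx : (t, x.2) ∈ K
  · rw [abs_mul (_ * _), abs_of_nonneg (Real.rpow_nonneg (hK0 _ hx).le _), mul_assoc 2, abs_mul 2,
      abs_two]
    ring
  · simp [hu0 _ hx]

lemma sq_mul_rpow_le_integral_snd (hK : IsCompact K) (hK0 : ∀ x ∈ K, 0 < x.2)
    (hu0 : ∀ x ∉ K, u x = 0) (hu : ContDiff ℝ 1 u) (r : ℝ) (x : ℝ × ℝ) :
    u x ^ 2 * x.2 ^ r ≤ ∫ t, 2 * |u (x.1, t) * fderiv ℝ u (x.1, t) (0, 1)| * t ^ r := by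
  have hF0 : ∀ x ∉ K, u x ^ 2 = 0 := fun x hx ↦ by simp [hu0 x hx]
  have hF := contDiff_mul_snd_rpow_s10 hK.isClosed hK0 hF0 (hu.pow 2) r
  have hg : ContDiff ℝ 1 fun t : ℝ ↦ u (x.1, t) ^ 2 * t ^ r :=
    hF.comp (contDiff_const.prodMk contDiff_id)
  have hgc : HasCompactSupport fun t : ℝ ↦ u (x.1, t) ^ 2 * t ^ r :=
    HasCompactSupport.intro (hK.image continuous_snd) fun t ht ↦ by
      rw [hu0 (x.1, t) fun h ↦ ht ⟨_, h, rfl⟩]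
      simp
  have hd : ∀ t, deriv (fun t : ℝ ↦ u (x.1, t) ^ 2 * t ^ r) t =
      2 * u (x.1, t) * fderiv ℝ u (x.1, t) (0, 1) * t ^ r +
        u (x.1, t) ^ 2 * (r * t ^ (r - 1)) := by
    intro t
    have h := (hF.differentiable one_ne_zero (x.1, t)).hasFDerivAt.comp_hasDerivAt t
      ((hasDerivAt_const t x.1).prodMk (hasDerivAt_id t))
    have h' : HasDerivAt (fun t : ℝ ↦ u (x.1, t) ^ 2 * t ^ r) _ t := h
    rw [h'.deriv, fderiv_mul_snd_rpow hK.isClosed hK0 hF0 (hu.pow 2), fderiv_sq_apply hu]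
    simp
  have hQ : Continuous fun t : ℝ ↦ 2 * |u (x.1, t) * fderiv ℝ u (x.1, t) (0, 1)| * t ^ r :=
    (continuous_mul_snd_rpow (f := fun x ↦ 2 * |u x * fderiv ℝ u x (0, 1)|) hK.isClosed hK0
      (fun x hx ↦ by simp [hu0 x hx])
      (continuous_const.mul (hu.continuous.mul (continuous_fderiv_apply_const hu _)).abs) r).comp
      (continuous_const.prodMk continuous_id)
  have hQc : HasCompactSupport
      fun t : ℝ ↦ 2 * |u (x.1, t) * fderiv ℝ u (x.1, t) (0, 1)| * t ^ r :=
    HasCompactSupport.intro (hK.image continuous_snd) fun t ht ↦ by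
      rw [hu0 (x.1, t) fun h ↦ ht ⟨_, h, rfl⟩]
      simp
  have hQi := hQ.integrable_of_hasCompactSupport hQc (μ := volume)
  have hQ0 : ∀ t : ℝ, 0 ≤ 2 * |u (x.1, t) * fderiv ℝ u (x.1, t) (0, 1)| * t ^ r := by
    intro t
    by_cases hx : (x.1, t) ∈ K
    · have := Real.rpow_nonneg (hK0 _ hx).le r
      positivity
    · simp [hu0 _ hx]
  rcases le_total r 0 with hr | hr
  · refine le_integral_of_deriv_le hg hgc hQi hQ0 (fun t ↦ ?_) x.2
    rw [hd]
    by_cases hx : (x.1, t) ∈ K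
    · have h1 := Real.rpow_nonneg (hK0 _ hx).le r
      have h2 := Real.rpow_nonneg (hK0 _ hx).le (r - 1)
      have h3 := mul_le_mul_of_nonneg_right
        (le_abs_self (u (x.1, t) * fderiv ℝ u (x.1, t) (0, 1))) h1
      have h4 := mul_nonneg (mul_nonneg (sq_nonneg (u (x.1, t))) (neg_nonneg.2 hr)) h2
      simp only at h3 h4
      linarith
    · simp [hu0 _ hx]
  · refine le_integral_of_neg_deriv_le hg hgc hQi hQ0 (fun t ↦ ?_) x.2
    rw [hd]
    by_cases hx : (x.1, t) ∈ K
    · have h1 := Real.rpow_nonneg (hK0 _ hx).le r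
      have h2 := Real.rpow_nonneg (hK0 _ hx).le (r - 1)
      have h3 := mul_le_mul_of_nonneg_right
        (neg_abs_le (u (x.1, t) * fderiv ℝ u (x.1, t) (0, 1))) h1
      have h4 := mul_nonneg (mul_nonneg (sq_nonneg (u (x.1, t))) hr) h2
      simp only at h3 h4
      linarith
    · simp [hu0 _ hx]

lemma mul_rpow_nonneg_of_eq_zero {f : ℝ × ℝ → ℝ} (hK0 : ∀ x ∈ K, 0 < x.2)
    (hf : ∀ x, 0 ≤ f x) (hf0 : ∀ x ∉ K, f x = 0) (r : ℝ) (x : ℝ × ℝ) : 0 ≤ f x * x.2 ^ r := by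
  by_cases hx : x ∈ K
  · exact mul_nonneg (hf x) (Real.rpow_nonneg (hK0 x hx).le r)
  · simp [hf0 x hx]

lemma integral_abs_mul_fderiv_fst_le (hK : IsCompact K) (hK0 : ∀ x ∈ K, 0 < x.2)
    (hu0 : ∀ x ∉ K, u x = 0) (hu0' : ∀ x ∉ K, fderiv ℝ u x = 0) (hu : ContDiff ℝ 1 u)
    {β c : ℝ} (hβ : -1 < β) (hc : 0 < c) :
    ∫ x, |u x * fderiv ℝ u x (1, 0)| * x.2 ^ (-β - 1) ≤
      (2 / (1 + β)) / (2 * c) * (c ^ 2 * (∫ x, fderiv ℝ u x (1, 0) ^ 2 * x.2 ^ (-β)) +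
        ∫ x, fderiv ℝ u x (0, 1) ^ 2 * x.2 ^ (-β)) := by
  have hC : 0 < 2 / (1 + β) := div_pos two_pos (by linarith)
  have hardy := integral_sq_mul_rpow_le_hardy hK hK0 hu0 hu0' hu hβ
  set C := 2 / (1 + β)
  have hI := integrable_mul_snd_rpow hK hK0 (fun x hx ↦ by simp [hu0 x hx] : ∀ x ∉ K, u x ^ 2 = 0)
    (hu.pow 2).continuous (-β - 2)
  have hJ := integrable_mul_snd_rpow (f := fun x ↦ fderiv ℝ u x (1, 0) ^ 2) hK hK0
    (fun x hx ↦ by simp [hu0' x hx]) ((continuous_fderiv_apply_const hu _).pow 2) (-β)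
  have hP := integrable_mul_snd_rpow (f := fun x ↦ |u x * fderiv ℝ u x (1, 0)|) hK hK0
    (fun x hx ↦ by simp [hu0 x hx])
    (hu.continuous.mul (continuous_fderiv_apply_const hu _)).abs (-β - 1)
  have hmono := integral_mono hP
    ((hI.const_mul (1 / (2 * c * C))).add (hJ.const_mul (C * c / 2))) (fun x ↦ by
      simp only [Pi.add_apply]
      by_cases hx : x ∈ K
      · obtain ⟨e1, e2⟩ := rpow_sub_add_identities (hK0 x hx) β
        have hw : 0 ≤ x.2 ^ (-β - 2) := Real.rpow_nonneg (hK0 x hx).le _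
        rw [e1, e2, abs_mul, ← sq_abs (u x), ← sq_abs (fderiv ℝ u x (1, 0))]
        have key : 0 ≤ x.2 ^ (-β - 2) / (2 * c * C) *
            (|u x| - C * c * |fderiv ℝ u x (1, 0)| * x.2) ^ 2 := by positivity
        have : x.2 ^ (-β - 2) / (2 * c * C) *
            (|u x| - C * c * |fderiv ℝ u x (1, 0)| * x.2) ^ 2 =
            1 / (2 * c * C) * (|u x| ^ 2 * x.2 ^ (-β - 2)) +
            C * c / 2 * (|fderiv ℝ u x (1, 0)| ^ 2 * (x.2 ^ (-β - 2) * x.2 ^ 2)) -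
            |u x| * |fderiv ℝ u x (1, 0)| * (x.2 ^ (-β - 2) * x.2) := by
          field_simp
          ring
        linarith
      · simp [hu0 x hx, hu0' x hx])
  simp only [Pi.add_apply] at hmono
  rw [integral_add (hI.const_mul _) (hJ.const_mul _), integral_const_mul, integral_const_mul]
    at hmono
  refine hmono.trans ((add_le_add_left (mul_le_mul_of_nonneg_left hardy (by positivity)) _).trans_eq
    ?_)
  field_simp
  ring

lemma integral_abs_mul_fderiv_snd_le (hK : IsCompact K) (hK0 : ∀ x ∈ K, 0 < x.2)
    {R : ℝ} (hR : 0 < R) (hKR : ∀ x ∈ K, x.1 ^ 2 ≤ R ^ 2)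
    (hu0 : ∀ x ∉ K, u x = 0) (hu0' : ∀ x ∉ K, fderiv ℝ u x = 0) (hu : ContDiff ℝ 1 u)
    {c : ℝ} (hc : 0 < c) (r : ℝ) :
    ∫ x, 2 * |u x * fderiv ℝ u x (0, 1)| * x.2 ^ r ≤
      2 * R / c * (c ^ 2 * (∫ x, fderiv ℝ u x (1, 0) ^ 2 * x.2 ^ r) +
        ∫ x, fderiv ℝ u x (0, 1) ^ 2 * x.2 ^ r) := by
  have poinc := integral_sq_mul_rpow_le_poincare hK hK0 hKR hu0 hu0' hu r
  have hI := integrable_mul_snd_rpow hK hK0 (fun x hx ↦ by simp [hu0 x hx] : ∀ x ∉ K, u x ^ 2 = 0)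
    (hu.pow 2).continuous r
  have hJ := integrable_mul_snd_rpow (f := fun x ↦ fderiv ℝ u x (0, 1) ^ 2) hK hK0
    (fun x hx ↦ by simp [hu0' x hx]) ((continuous_fderiv_apply_const hu _).pow 2) r
  have hP := integrable_mul_snd_rpow (f := fun x ↦ 2 * |u x * fderiv ℝ u x (0, 1)|) hK hK0
    (fun x hx ↦ by simp [hu0 x hx])
    (continuous_const.mul (hu.continuous.mul (continuous_fderiv_apply_const hu _)).abs) r
  have hmono := integral_mono hP
    ((hI.const_mul (c / (2 * R))).add (hJ.const_mul (2 * R / c))) (fun x ↦ by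
      simp only [Pi.add_apply]
      by_cases hx : x ∈ K
      · have hw : 0 ≤ x.2 ^ r := Real.rpow_nonneg (hK0 x hx).le _
        rw [abs_mul, ← sq_abs (u x), ← sq_abs (fderiv ℝ u x (0, 1))]
        have key : 0 ≤ x.2 ^ r * (c / (2 * R)) *
            (|u x| - 2 * R / c * |fderiv ℝ u x (0, 1)|) ^ 2 := by positivity
        have : x.2 ^ r * (c / (2 * R)) *
            (|u x| - 2 * R / c * |fderiv ℝ u x (0, 1)|) ^ 2 =
            c / (2 * R) * (|u x| ^ 2 * x.2 ^ r) +
            2 * R / c * (|fderiv ℝ u x (0, 1)| ^ 2 * x.2 ^ r) -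
            2 * (|u x| * |fderiv ℝ u x (0, 1)|) * x.2 ^ r := by
          field_simp
          ring
        linarith
      · simp [hu0 x hx, hu0' x hx])
  simp only [Pi.add_apply] at hmono
  rw [integral_add (hI.const_mul _) (hJ.const_mul _), integral_const_mul, integral_const_mul]
    at hmono
  refine hmono.trans ((add_le_add_left (mul_le_mul_of_nonneg_left poinc (by positivity)) _).trans_eq
    ?_)
  field_simp
  ring

/-- Weighted Ladyzhenskaya-type inequality. -/
lemma integral_pow_four_mul_rpow_le (hK : IsCompact K) (hK0 : ∀ x ∈ K, 0 < x.2)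
    {R : ℝ} (hR : 0 < R) (hKR : ∀ x ∈ K, x.1 ^ 2 ≤ R ^ 2)
    (hu0 : ∀ x ∉ K, u x = 0) (hu0' : ∀ x ∉ K, fderiv ℝ u x = 0) (hu : ContDiff ℝ 1 u)
    {β c : ℝ} (hβ : -1 < β) (hc : 0 < c) :
    ∫ x, u x ^ 4 * x.2 ^ (-2 * β - 1) ≤
      2 / (1 + β) * (R / c ^ 2) * (c ^ 2 * (∫ x, fderiv ℝ u x (1, 0) ^ 2 * x.2 ^ (-β)) +
        ∫ x, fderiv ℝ u x (0, 1) ^ 2 * x.2 ^ (-β)) ^ 2 := by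
  have hC : 0 < 2 / (1 + β) := div_pos two_pos (by linarith)
  have hPle := integral_abs_mul_fderiv_fst_le hK hK0 hu0 hu0' hu hβ hc
  have hQle := integral_abs_mul_fderiv_snd_le hK hK0 hR hKR hu0 hu0' hu hc (-β)
  set N := c ^ 2 * (∫ x, fderiv ℝ u x (1, 0) ^ 2 * x.2 ^ (-β)) +
    ∫ x, fderiv ℝ u x (0, 1) ^ 2 * x.2 ^ (-β)
  have hP0 : ∀ x, 0 ≤ |u x * fderiv ℝ u x (1, 0)| * x.2 ^ (-β - 1) :=
    mul_rpow_nonneg_of_eq_zero hK0 (fun x ↦ abs_nonneg _) (fun x hx ↦ by simp [hu0 x hx]) _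
  have hQ0 : ∀ x, 0 ≤ 2 * |u x * fderiv ℝ u x (0, 1)| * x.2 ^ (-β) :=
    mul_rpow_nonneg_of_eq_zero hK0 (fun x ↦ by positivity) (fun x hx ↦ by simp [hu0 x hx]) _
  have hP := integrable_mul_snd_rpow (f := fun x ↦ |u x * fderiv ℝ u x (1, 0)|) hK hK0
    (fun x hx ↦ by simp [hu0 x hx])
    (hu.continuous.mul (continuous_fderiv_apply_const hu _)).abs (-β - 1)
  have hQ := integrable_mul_snd_rpow (f := fun x ↦ 2 * |u x * fderiv ℝ u x (0, 1)|) hK hK0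
    (fun x hx ↦ by simp [hu0 x hx])
    (continuous_const.mul (hu.continuous.mul (continuous_fderiv_apply_const hu _)).abs) (-β)
  rw [Measure.volume_eq_prod] at hP hQ
  have hPs := integral_prod_symm _ hP
  have hQs := integral_prod _ hQ
  have hPi := hP.integral_prod_right
  have hQi := hQ.integral_prod_left
  simp only at hPs hQs hPi hQi
  rw [← Measure.volume_eq_prod] at hPs hQs
  rw [hPs] at hPle
  rw [hQs] at hQle
  calc ∫ x, u x ^ 4 * x.2 ^ (-2 * β - 1)
      ≤ ∫ x : ℝ × ℝ, (∫ s, 2 * |u (x.1, s) * fderiv ℝ u (x.1, s) (0, 1)| * s ^ (-β)) *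
          ∫ t, |u (t, x.2) * fderiv ℝ u (t, x.2) (1, 0)| * x.2 ^ (-β - 1) := by
        refine integral_mono_of_nonneg (Eventually.of_forall ?_) (hQi.mul_prod hPi)
          (Eventually.of_forall fun x ↦ ?_)
        · exact mul_rpow_nonneg_of_eq_zero hK0 (fun x ↦ by positivity)
            (fun x hx ↦ by simp [hu0 x hx]) _
        · have e : u x ^ 4 * x.2 ^ (-2 * β - 1) =
              (u x ^ 2 * x.2 ^ (-β)) * (u x ^ 2 * x.2 ^ (-β - 1)) := by
            by_cases hx : x ∈ K
            · rw [show -2 * β - 1 = -β + (-β - 1) by ring, Real.rpow_add (hK0 x hx)]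
              ring
            · simp [hu0 x hx]
          simp only [e]
          refine mul_le_mul (sq_mul_rpow_le_integral_snd hK hK0 hu0 hu _ x)
            (sq_mul_rpow_le_integral_fst hK hK0 hu0 hu _ x)
            (mul_rpow_nonneg_of_eq_zero hK0 (fun x ↦ sq_nonneg (u x))
              (fun x hx ↦ by simp [hu0 x hx]) _ x)
            (integral_nonneg fun s ↦ hQ0 (x.1, s))
    _ = (∫ x, ∫ s, 2 * |u (x, s) * fderiv ℝ u (x, s) (0, 1)| * s ^ (-β)) *
          ∫ y, ∫ t, |u (t, y) * fderiv ℝ u (t, y) (1, 0)| * y ^ (-β - 1) :=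
        integral_prod_mul (μ := volume) (ν := volume)
          (fun x : ℝ ↦ ∫ s, 2 * |u (x, s) * fderiv ℝ u (x, s) (0, 1)| * s ^ (-β))
          (fun y : ℝ ↦ ∫ t, |u (t, y) * fderiv ℝ u (t, y) (1, 0)| * y ^ (-β - 1))
    _ ≤ (2 * R / c * N) * ((2 / (1 + β)) / (2 * c) * N) :=
        mul_le_mul hQle hPle (integral_nonneg fun y ↦ integral_nonneg fun t ↦ hP0 (t, y))
          ((integral_nonneg fun x ↦ integral_nonneg fun s ↦ hQ0 (x, s)).trans hQle)
    _ = 2 / (1 + β) * (R / c ^ 2) * N ^ 2 := by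
        field_simp

end Energy

/-- Proposition 3.4 (small-p case): for `2 ≤ p ≤ 4`, `β > -1`, `δ = β/2 + (6-p)/(2p)`,
and smooth `ψ` compactly supported in the half-disc `B_R⁺`,
`(∫ |ψ/y^δ|^p)^{1/p} ≤ (2/(1+β))^{(6-p)/(2p)} (R/c²)^{(p-2)/(2p)} ‖∇_c ψ‖_β`. -/
theorem prop_3_4 (c R β p : ℝ) (hc : 0 < c) (hR : 0 < R) (hβ : -1 < β)
    (hp2 : 2 ≤ p) (hp4 : p ≤ 4)
    (ψ : ℝ × ℝ → ℝ) (hψ : ContDiff ℝ (⊤ : ℕ∞) ψ) (hψc : HasCompactSupport ψ)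
    (hψs : tsupport ψ ⊆ halfDisc R) :
    (∫ x in halfDisc R, |ψ x / x.2 ^ (β / 2 + (6 - p) / (2 * p))| ^ p) ^ (1 / p)
      ≤ (2 / (1 + β)) ^ ((6 - p) / (2 * p)) * (R / c ^ 2) ^ ((p - 2) / (2 * p)) *
        (∫ x in halfDisc R,
          (c ^ 2 * (fderiv ℝ ψ x (1, 0)) ^ 2 + (fderiv ℝ ψ x (0, 1)) ^ 2) * x.2 ^ (-β))
          ^ ((1 : ℝ) / 2) := by
  have hp : 0 < p := by linarith
  have hC : 0 < 2 / (1 + β) := div_pos two_pos (by linarith)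
  have hu : ContDiff ℝ 1 ψ := hψ.of_le (by exact_mod_cast le_top)
  have hK : IsCompact (tsupport ψ) := hψc
  have hK0 : ∀ x ∈ tsupport ψ, 0 < x.2 := fun x hx ↦ (hψs hx).2
  have hKR : ∀ x ∈ tsupport ψ, x.1 ^ 2 ≤ R ^ 2 := fun x hx ↦ by
    have := (hψs hx).1
    nlinarith [sq_nonneg x.2]
  have hu0 : ∀ x ∉ tsupport ψ, ψ x = 0 := fun x hx ↦ image_eq_zero_of_notMem_tsupport hx
  have hu0' : ∀ x ∉ tsupport ψ, fderiv ℝ ψ x = 0 := fun x hx ↦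
    image_eq_zero_of_notMem_tsupport fun h ↦ hx (tsupport_fderiv_subset ℝ h)
  have hardy := integral_sq_mul_rpow_le_hardy hK hK0 hu0 hu0' hu hβ
  have hfour := integral_pow_four_mul_rpow_le hK hK0 hR hKR hu0 hu0' hu hβ hc
  rw [setIntegral_eq_integral_of_forall_compl_eq_zero
    (fun x hx ↦ by simp [hu0 x fun h ↦ hx (hψs h), Real.zero_rpow hp.ne']),
    setIntegral_eq_integral_of_forall_compl_eq_zero
    (fun x hx ↦ by simp [hu0' x fun h ↦ hx (hψs h)])]
  have hJ1 := integrable_mul_snd_rpow (f := fun x ↦ fderiv ℝ ψ x (1, 0) ^ 2) hK hK0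
    (fun x hx ↦ by simp [hu0' x hx]) ((continuous_fderiv_apply_const hu _).pow 2) (-β)
  have hJ2 := integrable_mul_snd_rpow (f := fun x ↦ fderiv ℝ ψ x (0, 1) ^ 2) hK hK0
    (fun x hx ↦ by simp [hu0' x hx]) ((continuous_fderiv_apply_const hu _).pow 2) (-β)
  have hN : ∫ x, (c ^ 2 * (fderiv ℝ ψ x (1, 0)) ^ 2 + (fderiv ℝ ψ x (0, 1)) ^ 2) * x.2 ^ (-β) =
      c ^ 2 * (∫ x, fderiv ℝ ψ x (1, 0) ^ 2 * x.2 ^ (-β)) +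
        ∫ x, fderiv ℝ ψ x (0, 1) ^ 2 * x.2 ^ (-β) := by
    rw [← integral_const_mul, ← integral_add (hJ1.const_mul _) hJ2]
    congr 1 with x
    ring
  rw [hN]
  have hN1 : 0 ≤ ∫ x, fderiv ℝ ψ x (1, 0) ^ 2 * x.2 ^ (-β) :=
    integral_nonneg (mul_rpow_nonneg_of_eq_zero hK0 (fun x ↦ sq_nonneg (fderiv ℝ ψ x (1, 0)))
      (fun x hx ↦ by simp [hu0' x hx]) _)
  have hN2 : 0 ≤ ∫ x, fderiv ℝ ψ x (0, 1) ^ 2 * x.2 ^ (-β) :=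
    integral_nonneg (mul_rpow_nonneg_of_eq_zero hK0 (fun x ↦ sq_nonneg (fderiv ℝ ψ x (0, 1)))
      (fun x hx ↦ by simp [hu0' x hx]) _)
  set N1 := ∫ x, fderiv ℝ ψ x (1, 0) ^ 2 * x.2 ^ (-β)
  set N2 := ∫ x, fderiv ℝ ψ x (0, 1) ^ 2 * x.2 ^ (-β)
  set C := 2 / (1 + β)
  set N := c ^ 2 * N1 + N2
  have hN0 : 0 ≤ N := by positivity
  have hN2N : N2 ≤ N := le_add_of_nonneg_left (by positivity)
  set D := R / c ^ 2
  have hD : 0 < D := by positivity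
  have hX := integrable_mul_snd_rpow hK hK0 (fun x hx ↦ by simp [hu0 x hx] :
    ∀ x ∉ tsupport ψ, ψ x ^ 2 = 0) (hu.pow 2).continuous (-β - 2)
  have hY := integrable_mul_snd_rpow hK hK0 (fun x hx ↦ by simp [hu0 x hx] :
    ∀ x ∉ tsupport ψ, ψ x ^ 4 = 0) (hu.pow 4).continuous (-2 * β - 1)
  have hX0 := mul_rpow_nonneg_of_eq_zero hK0 (fun x ↦ by positivity) (fun x hx ↦ by simp [hu0 x hx] :
    ∀ x ∉ tsupport ψ, ψ x ^ 2 = 0) (-β - 2)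
  have hY0 := mul_rpow_nonneg_of_eq_zero hK0 (fun x ↦ by positivity) (fun x hx ↦ by simp [hu0 x hx] :
    ∀ x ∉ tsupport ψ, ψ x ^ 4 = 0) (-2 * β - 1)
  have hZ : ∀ x : ℝ × ℝ, |ψ x / x.2 ^ (β / 2 + (6 - p) / (2 * p))| ^ p ≤
      (ψ x ^ 2 * x.2 ^ (-β - 2)) ^ (1 - (p - 2) / 2) *
        (ψ x ^ 4 * x.2 ^ (-2 * β - 1)) ^ ((p - 2) / 2) := by
    intro x
    by_cases h0 : ψ x = 0
    · have e : |ψ x / x.2 ^ (β / 2 + (6 - p) / (2 * p))| ^ p = 0 := by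
        rw [h0, zero_div, abs_zero, Real.zero_rpow hp.ne']
      rw [e]
      exact mul_nonneg (Real.rpow_nonneg (hX0 x) _) (Real.rpow_nonneg (hY0 x) _)
    · have hy : 0 < x.2 := hK0 x (by by_contra h; exact h0 (hu0 x h))
      have ha : 0 < |ψ x| := abs_pos.2 h0
      have e2 : ψ x ^ 2 = |ψ x| ^ (2 : ℝ) := by simp
      have e4 : ψ x ^ 4 = |ψ x| ^ (4 : ℝ) := by
        rw [show (4 : ℝ) = ((4 : ℕ) : ℝ) by norm_num, Real.rpow_natCast]
        exact (Even.pow_abs (by decide) _).symm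
      rw [e2, e4, abs_div, abs_of_pos (Real.rpow_pos_of_pos hy _), div_eq_mul_inv,
        ← Real.rpow_neg hy.le, Real.mul_rpow ha.le (by positivity),
        Real.mul_rpow (by positivity) (by positivity),
        Real.mul_rpow (by positivity) (by positivity),
        ← Real.rpow_mul ha.le, ← Real.rpow_mul ha.le, ← Real.rpow_mul hy.le, ← Real.rpow_mul hy.le,
        ← Real.rpow_mul hy.le, mul_mul_mul_comm, ← Real.rpow_add ha, ← Real.rpow_add hy]
      apply le_of_eq
      congr 2
      · ring
      · field_simp
        ring
  have hbound : ∀ M, N < M →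
      (∫ x : ℝ × ℝ, |ψ x / x.2 ^ (β / 2 + (6 - p) / (2 * p))| ^ p) ^ (1 / p) ≤
        C ^ ((6 - p) / (2 * p)) * D ^ ((p - 2) / (2 * p)) * M ^ ((1 : ℝ) / 2) := by
    intro M hM
    have hM0 : 0 < M := hN0.trans_lt hM
    have h := integral_le_rpow_mul_rpow (t := (p - 2) / 2) (A := C ^ 2 * M) (B := C * D * M ^ 2)
      hX hY hX0 hY0 (fun x ↦ by positivity) hZ (by positivity) (by positivity) (by linarith)
      (by linarith) (hardy.trans (by gcongr; linarith)) (hfour.trans (by gcongr))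
    refine (Real.rpow_le_rpow (integral_nonneg fun x ↦ by positivity) h (by positivity)).trans_eq ?_
    rw [← Real.rpow_natCast C, ← Real.rpow_natCast M, Real.mul_rpow (by positivity) (by positivity),
      Real.mul_rpow (by positivity) (by positivity), Real.mul_rpow (by positivity) (by positivity),
      Real.mul_rpow (by positivity) (by positivity), Real.mul_rpow (by positivity) (by positivity),
      Real.mul_rpow hC.le hD.le, Real.mul_rpow (by positivity) (by positivity)]
    simp only [← Real.rpow_mul hC.le, ← Real.rpow_mul hD.le, ← Real.rpow_mul hM0.le]
    rw [show ∀ a b d e f : ℝ, a * b * (d * e * f) = a * d * e * (b * f) by intros; ring,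
      ← Real.rpow_add hC, ← Real.rpow_add hM0]
    congr 2
    · congr 1
      field_simp
      push_cast
      ring
    · congr 1
      field_simp
    · field_simp
      push_cast
      ring
  have hcont : Continuous fun M : ℝ ↦
      C ^ ((6 - p) / (2 * p)) * D ^ ((p - 2) / (2 * p)) * M ^ ((1 : ℝ) / 2) :=
    continuous_const.mul (Real.continuous_rpow_const (by norm_num))
  refine ge_of_tendsto ((hcont.tendsto N).mono_left nhdsWithin_le_nhds : Tendsto _ (𝓝[>] N) _) ?_
  filter_upwards [self_mem_nhdsWithin] with M hM using hbound M hM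
end
end

section
/- Let E and F be real Banach spaces which are reflexive (the canonical embedding of each into its double dual is surjective). Let B : E × F → ℝ be a bilinear map for which there is K ≥ 0 with |B(u,ũ)| ≤ K‖u‖·‖ũ‖ for all u ∈ E, ũ ∈ F, and suppose there are constants c > 0 and c̃ > 0 such that: (i) for every u ∈ E the continuous linear functional B(u,·) on F has dual norm at least c‖u‖, and (ii) for every ũ ∈ F the continuous linear functional B(·,ũ) on E has dual norm at least c̃‖ũ‖. Then for every continuous linear functional w on F there exists a unique u ∈ E such that B(u,ũ) = w(ũ) for all ũ ∈ F, and this u satisfies ‖u‖ ≤ ‖w‖/c. (Proposition 5.1, generalized Lax–Milgram criterion) -/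
noncomputable section

/-- Hahn–Banach: a proper closed subspace is annihilated by a nonzero continuous functional. -/
theorem exists_ne_zero_forall_mem_eq_zero {X : Type*} [NormedAddCommGroup X] [NormedSpace ℝ X]
    (S : Submodule ℝ X) (hS : IsClosed (S : Set X)) {x : X} (hx : x ∉ S) :
    ∃ φ : X →L[ℝ] ℝ, φ x ≠ 0 ∧ ∀ y ∈ S, φ y = 0 := by
  have : IsClosed (S : Set X) := hS
  have hne : S.mkQL x ≠ 0 := by simpa using hx
  obtain ⟨g, hg⟩ := SeparatingDual.exists_ne_zero (R := ℝ) hne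
  refine ⟨g.comp S.mkQL, hg, fun y hy => ?_⟩
  have hy0 : S.mkQL y = 0 := by simpa using hy
  simp [hy0]

/-- The supremum of the quotients `|f x| / ‖x‖` is at most the operator norm. -/
theorem iSup_abs_div_norm_le {X : Type*} [NormedAddCommGroup X] [NormedSpace ℝ X]
    (f : X →L[ℝ] ℝ) : ⨆ x, |f x| / ‖x‖ ≤ ‖f‖ :=
  ciSup_le fun x => f.ratio_le_opNorm x

/-- Proposition 5.1 (generalized Lax–Milgram criterion): given reflexive real Banach
spaces `E`, `F`, a bounded bilinear form `B` on `E × F` satisfying the two coercivity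
conditions (expressed via the dual norms `sup |B(u,·)|/‖·‖ ≥ c‖u‖` and
`sup |B(·,ũ)|/‖·‖ ≥ c̃‖ũ‖`), every continuous linear functional `w` on `F` is uniquely
represented as `B(u,·)` for some `u ∈ E`, with `‖u‖ ≤ ‖w‖/c`. -/
theorem generalized_lax_milgram
    (E F : Type*) [NormedAddCommGroup E] [NormedSpace ℝ E] [CompleteSpace E]
    [NormedAddCommGroup F] [NormedSpace ℝ F] [CompleteSpace F]
    (hErefl : Function.Surjective (NormedSpace.inclusionInDoubleDual ℝ E))
    (hFrefl : Function.Surjective (NormedSpace.inclusionInDoubleDual ℝ F))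
    (B : E →ₗ[ℝ] F →ₗ[ℝ] ℝ) (K : ℝ) (hK : 0 ≤ K)
    (hbound : ∀ (u : E) (v : F), |B u v| ≤ K * ‖u‖ * ‖v‖)
    (c ct : ℝ) (hc : 0 < c) (hct : 0 < ct)
    (hcoer₁ : ∀ u : E, c * ‖u‖ ≤ ⨆ v : F, |B u v| / ‖v‖)
    (hcoer₂ : ∀ v : F, ct * ‖v‖ ≤ ⨆ u : E, |B u v| / ‖u‖) :
    ∀ w : F →L[ℝ] ℝ, ∃ u : E, (∀ v : F, B u v = w v) ∧ ‖u‖ ≤ ‖w‖ / c ∧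
      ∀ u' : E, (∀ v : F, B u' v = w v) → u' = u := by
  intro w
  let T : E →L[ℝ] F →L[ℝ] ℝ := B.mkContinuous₂ K hbound
  have hT (u : E) (v : F) : T u v = B u v := rfl
  have hlower (u : E) : c * ‖u‖ ≤ ‖T u‖ := (hcoer₁ u).trans (iSup_abs_div_norm_le (T u))
  have hanti : AntilipschitzWith (Real.toNNReal c⁻¹) T := by
    refine T.antilipschitz_of_bound fun u => ?_
    rw [Real.coe_toNNReal _ (inv_nonneg.2 hc.le), inv_mul_eq_div, le_div_iff₀ hc, mul_comm]
    exact hlower u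
  have hclosed : IsClosed (T.range : Set (F →L[ℝ] ℝ)) := hanti.isClosed_range T.uniformContinuous
  have hmem : w ∈ T.range := by
    by_contra hw
    obtain ⟨φ, hφw, hφ⟩ := exists_ne_zero_forall_mem_eq_zero T.range hclosed hw
    obtain ⟨v, rfl⟩ := hFrefl φ
    have hBv (u : E) : B u v = 0 := hφ (T u) ⟨u, rfl⟩
    have hv : ‖v‖ ≤ 0 := by
      have h := hcoer₂ v
      simp only [hBv, abs_zero, zero_div, ciSup_const] at h
      exact nonpos_of_mul_nonpos_right h hct
    rw [norm_le_zero_iff.1 hv] at hφw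
    simp at hφw
  obtain ⟨u, rfl⟩ := hmem
  refine ⟨u, fun v => rfl, ?_, fun u' hu' => hanti.injective (ContinuousLinearMap.ext hu')⟩
  rw [le_div_iff₀ hc, mul_comm]
  exact hlower u
end
end
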